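/- Let G be an n-vertex Δ-critical simple graph with minimum degree at least 4 and maximum degree Δ ≥ 6^30. Then α(G) < 4n/7. -/

import Mathlib

open Finset

variable {V : Type*}

/-- `φ` is a proper edge coloring of `G` with colors in `{1, …, k}`, encoded as a symmetric
function on ordered pairs of vertices: every edge receives a color in `[1,k]` and two distinct
edges sharing a vertex receive different colors. -/
def IsEdgeColoring (G : SimpleGraph V) (k : ℕ) (φ : V → V → ℕ) : Prop :=
  (∀ u v, φ u v = φ v u) ∧
  (∀ ⦃u v⦄, G.Adj u v → φ u v ∈ Finset.Icc 1 k) ∧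
  (∀ ⦃v a b⦄, G.Adj v a → G.Adj v b → a ≠ b → φ v a ≠ φ v b)

/-- The chromatic index of `G`: the least `k` such that `G` has a proper edge `k`-coloring. -/
noncomputable def chromIndex (G : SimpleGraph V) : ℕ :=
  sInf {k | ∃ φ : V → V → ℕ, IsEdgeColoring G k φ}

/-- `G` is `Δ`-critical: `G` is connected, `χ'(G) = Δ + 1`, and `χ'(G - e) = Δ` for every
edge `e` of `G`, where `Δ` is the maximum degree of `G`. -/
def IsDeltaCritical [Fintype V] (G : SimpleGraph V) [DecidableRel G.Adj] : Prop :=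
  G.Connected ∧ chromIndex G = G.maxDegree + 1 ∧
    ∀ e ∈ G.edgeSet, chromIndex (G.deleteEdges {e}) = G.maxDegree

/-- The independence number of `G`. -/
noncomputable def indepNum [Fintype V] (G : SimpleGraph V) : ℕ :=
  sSup {n | ∃ s : Finset V, (∀ u ∈ s, ∀ v ∈ s, u ≠ v → ¬ G.Adj u v) ∧ s.card = n}


lemma three_ends_graph {V : Type*} [Fintype V] (K : SimpleGraph V)
    (hK : ∀ v a b c, K.Adj v a → K.Adj v b → K.Adj v c → a = b ∨ a = c ∨ b = c)
    {u v w : V} (huv : u ≠ v) (huw : u ≠ w) (hvw : v ≠ w)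
    (hu : ∀ a b, K.Adj u a → K.Adj u b → a = b)
    (hv : ∀ a b, K.Adj v a → K.Adj v b → a = b)
    (hw : ∀ a b, K.Adj w a → K.Adj w b → a = b)
    (h1 : K.Reachable u v) (h2 : K.Reachable u w) : False := by
  classical
  set c := K.connectedComponentMk u with hc
  have hcon : (K.induce c.supp).Connected := c.connected_toSimpleGraph
  set H := K.induce c.supp with hH
  have h3 := hcon.card_vert_le_card_edgeSet_add_one
  have h4 := H.sum_degrees_eq_twice_card_edges
  have hu' : u ∈ c.supp := by simp [hc]
  have hv' : v ∈ c.supp := by simp [hc]; exact h1.symm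
  have hw' : w ∈ c.supp := by simp [hc]; exact h2.symm
  have hd2 : ∀ z, H.degree z ≤ 2 := by
    intro z
    by_contra hcon
    push Not at hcon
    rw [← SimpleGraph.card_neighborFinset_eq_degree, Finset.two_lt_card] at hcon
    obtain ⟨a, ha, b, hb, d, hd, hab, had, hbd⟩ := hcon
    simp [hH] at ha hb hd
    rcases hK z a b d ha hb hd with h | h | h
    · exact hab (Subtype.ext h)
    · exact had (Subtype.ext h)
    · exact hbd (Subtype.ext h)
  have hd1 : ∀ z : c.supp, (∀ a b, K.Adj z a → K.Adj z b → a = b) → H.degree z ≤ 1 := by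
    intro z hz
    rw [← SimpleGraph.card_neighborFinset_eq_degree, Finset.card_le_one]
    intro a ha b hb
    simp [hH] at ha hb
    exact Subtype.ext (hz _ _ ha hb)
  have hsum : ∑ z, H.degree z + 3 ≤ 2 * Fintype.card c.supp := by
    have : ∑ z : c.supp, (H.degree z + if z ∈ ({⟨u,hu'⟩, ⟨v,hv'⟩, ⟨w,hw'⟩} : Finset c.supp) then 1 else 0) ≤ ∑ z : c.supp, 2 := by
      apply Finset.sum_le_sum
      intro z _
      split_ifs with h
      · have : H.degree z ≤ 1 := by
          simp only [Finset.mem_insert, Finset.mem_singleton] at h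
          rcases h with h | h | h <;> rw [h] <;> apply hd1 <;> assumption
        omega
      · have := hd2 z; omega
    rw [Finset.sum_add_distrib] at this
    have hcard : ({⟨u,hu'⟩, ⟨v,hv'⟩, ⟨w,hw'⟩} : Finset c.supp).card = 3 := by
      rw [Finset.card_eq_three]
      exact ⟨_, _, _, by simpa using huv, by simpa using huw, by simpa using hvw, rfl⟩
    rw [Finset.sum_ite_mem, Finset.univ_inter, Finset.sum_const, hcard] at this
    simp at this
    rw [← Nat.card_eq_fintype_card] at *
    simp at *
    omega
  rw [Nat.card_eq_fintype_card, Nat.card_eq_fintype_card] at h3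
  rw [h4, SimpleGraph.edgeFinset_card] at hsum
  omega


section basics
variable {V : Type*} {G : SimpleGraph V} {D : ℕ} {x y : V} {φ : V → V → ℕ}

/-- A proper partial edge coloring of `G` with colors `1..D` in which exactly the edge `xy`
is uncolored (color `0` stands for uncolored or nonadjacent). -/
structure PC (G : SimpleGraph V) (D : ℕ) (x y : V) (φ : V → V → ℕ) : Prop where
  adj : G.Adj x y
  symm : ∀ u v, φ u v = φ v u
  le : ∀ u v, φ u v ≤ D
  inj : ∀ v a b, φ v a = φ v b → φ v a ≠ 0 → a = b
  ne0 : ∀ u v, φ u v ≠ 0 ↔ G.Adj u v ∧ ¬(u = x ∧ v = y) ∧ ¬(u = y ∧ v = x)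

open Classical in
/-- colors missing at `v` -/
noncomputable def ms (D : ℕ) (φ : V → V → ℕ) (v : V) : Finset ℕ :=
  (Finset.Icc 1 D).filter (fun c => ∀ w, φ v w ≠ c)

lemma mem_ms {v : V} {c : ℕ} : c ∈ ms D φ v ↔ 1 ≤ c ∧ c ≤ D ∧ ∀ w, φ v w ≠ c := by
  simp [ms, and_assoc]

lemma PC.swapEnds (h : PC G D x y φ) : PC G D y x φ :=
  ⟨h.adj.symm, h.symm, h.le, h.inj, fun u v => by rw [h.ne0]; tauto⟩

lemma PC.xy0 (h : PC G D x y φ) : φ x y = 0 := by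
  by_contra hh
  exact ((h.ne0 x y).1 hh).2.1 ⟨rfl, rfl⟩

lemma PC.yx0 (h : PC G D x y φ) : φ y x = 0 := by rw [h.symm]; exact h.xy0

lemma PC.self0 (h : PC G D x y φ) (v : V) : φ v v = 0 := by
  by_contra hh
  exact ((h.ne0 v v).1 hh).1.ne rfl

lemma PC.adj' (h : PC G D x y φ) {u v : V} (hh : φ u v ≠ 0) : G.Adj u v := ((h.ne0 u v).1 hh).1

/-- no full coloring -/
def NoFull (G : SimpleGraph V) (D : ℕ) : Prop := ∀ ψ : V → V → ℕ, ¬ IsEdgeColoring G D ψ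

open Classical in
/-- recolor one edge -/
noncomputable def upd (φ : V → V → ℕ) (a b : V) (c : ℕ) (u v : V) : ℕ :=
  if (u = a ∧ v = b) ∨ (u = b ∧ v = a) then c else φ u v

lemma upd_eq (a b : V) (c : ℕ) : upd φ a b c a b = c := by simp [upd]
lemma upd_eq' (a b : V) (c : ℕ) : upd φ a b c b a = c := by simp [upd]
lemma upd_ne {a b : V} {c : ℕ} {u v : V} (h : ¬ ((u = a ∧ v = b) ∨ (u = b ∧ v = a))) :
    upd φ a b c u v = φ u v := by simp [upd, h]

lemma PC.no_common (h : PC G D x y φ) (hN : NoFull G D) {c : ℕ} (hx : c ∈ ms D φ x)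
    (hy : c ∈ ms D φ y) : False := by
  rw [mem_ms] at hx hy
  apply hN (upd φ x y c)
  have hs := h.symm
  refine ⟨?_, ?_, ?_⟩
  · intro u v; unfold upd; rw [hs u v]; congr 1; apply propext; tauto
  · intro u v huv
    by_cases hh : (u = x ∧ v = y) ∨ (u = y ∧ v = x)
    · simp [upd, hh]; omega
    · rw [upd_ne hh]
      have := (h.ne0 u v).2 ⟨huv, by tauto⟩
      have := h.le u v
      simp; omega
  · intro v a b hva hvb hab
    by_cases ha : (v = x ∧ a = y) ∨ (v = y ∧ a = x)
    · by_cases hb : (v = x ∧ b = y) ∨ (v = y ∧ b = x)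
      · have := h.adj.ne
        grind
      · rw [upd_ne hb]
        simp only [upd, ha, if_true]
        rcases ha with ha | ha
        · rw [ha.1]; exact (hx.2.2 b).symm
        · rw [ha.1]; exact (hy.2.2 b).symm
    · rw [upd_ne ha]
      by_cases hb : (v = x ∧ b = y) ∨ (v = y ∧ b = x)
      · simp only [upd, hb, if_true]
        rcases hb with ha | ha
        · rw [ha.1]; exact (hx.2.2 a)
        · rw [ha.1]; exact (hy.2.2 a)
      · rw [upd_ne hb]
        intro e
        exact hab (h.inj v a b e ((h.ne0 v a).2 ⟨hva, by tauto⟩))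

/-- Kempe graph -/
def KG (φ : V → V → ℕ) (a b : ℕ) : SimpleGraph V :=
  SimpleGraph.fromRel (fun u v => φ u v = a ∨ φ u v = b)

lemma PC.kg_adj (h : PC G D x y φ) {a b : ℕ} (ha : 1 ≤ a) (hb : 1 ≤ b) (u v : V) :
    (KG φ a b).Adj u v ↔ φ u v = a ∨ φ u v = b := by
  simp only [KG, SimpleGraph.fromRel_adj]
  rw [h.symm v u]
  constructor
  · tauto
  · intro hh
    refine ⟨?_, Or.inl hh⟩
    rintro rfl
    rw [h.self0] at hh
    omega

lemma KG_comm (a b : ℕ) : KG φ a b = KG φ b a := by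
  ext u v; simp only [KG, SimpleGraph.fromRel_adj]; tauto

/-- same Kempe component -/
def R (φ : V → V → ℕ) (a b : ℕ) (u v : V) : Prop := (KG φ a b).Reachable u v

lemma R_comm {a b : ℕ} {u v : V} : R φ a b u v ↔ R φ b a u v := by unfold R; rw [KG_comm]

lemma PC.three_ends [Fintype V] (h : PC G D x y φ) {a b : ℕ} (ha : 1 ≤ a) (hb : 1 ≤ b) {u v w : V}
    (huv : u ≠ v) (huw : u ≠ w) (hvw : v ≠ w)
    (hu : a ∈ ms D φ u ∨ b ∈ ms D φ u) (hv : a ∈ ms D φ v ∨ b ∈ ms D φ v)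
    (hw : a ∈ ms D φ w ∨ b ∈ ms D φ w) (h1 : R φ a b u v) (h2 : R φ a b u w) : False := by
  have key : ∀ z, (a ∈ ms D φ z ∨ b ∈ ms D φ z) →
      ∀ p q, (KG φ a b).Adj z p → (KG φ a b).Adj z q → p = q := by
    intro z hz p q hp hq
    rw [h.kg_adj ha hb] at hp hq
    rw [mem_ms, mem_ms] at hz
    have hi := h.inj z p q
    have h1 : a ≠ 0 := by omega
    have h2 : b ≠ 0 := by omega
    rcases hz with hz | hz
    · have hzp := hz.2.2 p
      have hzq := hz.2.2 q
      apply hi <;> grind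
    · have hzp := hz.2.2 p
      have hzq := hz.2.2 q
      apply hi <;> grind
  refine three_ends_graph (KG φ a b) ?_ huv huw hvw (key u hu) (key v hv) (key w hw) h1 h2
  intro z p q r hp hq hr
  rw [h.kg_adj ha hb] at hp hq hr
  have hpq := h.inj z p q
  have hpr := h.inj z p r
  have hqr := h.inj z q r
  have h1 : a ≠ 0 := by omega
  have h2 : b ≠ 0 := by omega
  grind

/-- `C` is a union of Kempe components -/
def KC (φ : V → V → ℕ) (a b : ℕ) (C : Set V) : Prop :=
  ∀ u v, (φ u v = a ∨ φ u v = b) → u ∈ C → v ∈ C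

/-- the Kempe component of `w` -/
def comp (φ : V → V → ℕ) (a b : ℕ) (w : V) : Set V := {u | R φ a b w u}

lemma PC.kc_comp (h : PC G D x y φ) {a b : ℕ} (ha : 1 ≤ a) (hb : 1 ≤ b) (w : V) :
    KC φ a b (comp φ a b w) := by
  intro u v huv hu
  have := (h.kg_adj ha hb u v).2 huv
  exact SimpleGraph.Reachable.trans hu this.reachable

open Classical in
/-- Kempe swap -/
noncomputable def swp (φ : V → V → ℕ) (a b : ℕ) (C : Set V) (u v : V) : ℕ :=
  if u ∈ C then Equiv.swap a b (φ u v) else φ u v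

lemma swp_in {a b : ℕ} {C : Set V} {u v : V} (h : u ∈ C) :
    swp φ a b C u v = Equiv.swap a b (φ u v) := by simp [swp, h]
lemma swp_out {a b : ℕ} {C : Set V} {u v : V} (h : u ∉ C) :
    swp φ a b C u v = φ u v := by simp [swp, h]

lemma swp_other {a b c : ℕ} {C : Set V} {u v : V} (h1 : c ≠ a) (h2 : c ≠ b) :
    swp φ a b C u v = c ↔ φ u v = c := by
  by_cases h : u ∈ C
  · rw [swp_in h]
    rw [Equiv.swap_apply_eq_iff, Equiv.swap_apply_of_ne_of_ne h1 h2]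
  · rw [swp_out h]

lemma PC.kswap (h : PC G D x y φ) {a b : ℕ} (ha : 1 ≤ a) (hb : 1 ≤ b) (ha' : a ≤ D) (hb' : b ≤ D)
    {C : Set V} (hC : KC φ a b C) : PC G D x y (swp φ a b C) := by
  have h0 : ∀ u v, swp φ a b C u v = 0 ↔ φ u v = 0 := fun u v =>
    swp_other (by omega) (by omega)
  refine ⟨h.adj, ?_, ?_, ?_, ?_⟩
  · intro u v
    have hs := h.symm u v
    have c1 := hC u v
    have c2 := hC v u
    by_cases hu : u ∈ C <;> by_cases hv : v ∈ C
    · rw [swp_in hu, swp_in hv, hs]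
    · rw [swp_in hu, swp_out hv, Equiv.swap_apply_of_ne_of_ne, hs] <;> grind
    · rw [swp_in hv, swp_out hu, Equiv.swap_apply_of_ne_of_ne, hs] <;> grind
    · rw [swp_out hu, swp_out hv, hs]
  · intro u v
    have := h.le u v
    by_cases hu : u ∈ C
    · rw [swp_in hu, Equiv.swap_apply_def]; split_ifs <;> omega
    · rw [swp_out hu]; exact this
  · intro v p q e hne
    rw [Ne, h0] at hne
    apply h.inj v p q _ hne
    by_cases hu : v ∈ C
    · rw [swp_in hu, swp_in hu] at e; exact (Equiv.swap a b).injective e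
    · rwa [swp_out hu, swp_out hu] at e
  · intro u v
    rw [Ne, h0]; exact h.ne0 u v

lemma ms_swp_out {a b : ℕ} {C : Set V} {v : V} (h : v ∉ C) :
    ms D (swp φ a b C) v = ms D φ v := by
  ext c; simp only [mem_ms, swp_out h]

lemma ms_swp_other {a b c : ℕ} {C : Set V} {v : V} (h1 : c ≠ a) (h2 : c ≠ b) :
    c ∈ ms D (swp φ a b C) v ↔ c ∈ ms D φ v := by
  simp only [mem_ms, Ne, swp_other h1 h2]

lemma ms_swp_in_left {a b : ℕ} {C : Set V} {v : V} (h : v ∈ C) (ha : 1 ≤ a) (ha' : a ≤ D)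
    (hb : b ∈ ms D φ v) : a ∈ ms D (swp φ a b C) v := by
  rw [mem_ms] at *
  refine ⟨ha, ha', fun w => ?_⟩
  rw [swp_in h, Ne, Equiv.swap_apply_eq_iff, Equiv.swap_apply_left]
  exact hb.2.2 w

lemma ms_swp_in_right {a b : ℕ} {C : Set V} {v : V} (h : v ∈ C) (hb : 1 ≤ b) (hb' : b ≤ D)
    (ha : a ∈ ms D φ v) : b ∈ ms D (swp φ a b C) v := by
  rw [mem_ms] at *
  refine ⟨hb, hb', fun w => ?_⟩
  rw [swp_in h, Ne, Equiv.swap_apply_eq_iff, Equiv.swap_apply_right]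
  exact ha.2.2 w

/-- F1 -/
lemma PC.F1 [Fintype V] (h : PC G D x y φ) (hN : NoFull G D) {a c : ℕ} (ha : a ∈ ms D φ x)
    (hc : c ∈ ms D φ y) : a ≠ c ∧ R φ a c x y := by
  have hne : a ≠ c := by
    rintro rfl; exact h.no_common hN ha hc
  refine ⟨hne, ?_⟩
  by_contra hR
  have ha1 := mem_ms.1 ha
  have hc1 := mem_ms.1 hc
  set C := comp φ a c y with hCdef
  have hC : KC φ a c C := h.kc_comp ha1.1 hc1.1 y
  have hxC : x ∉ C := fun hh => hR (SimpleGraph.Reachable.symm hh)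
  have hyC : y ∈ C := SimpleGraph.Reachable.refl y
  have h' := h.kswap ha1.1 hc1.1 ha1.2.1 hc1.2.1 hC
  exact h'.no_common hN (c := a) (by rw [ms_swp_out hxC]; exact ha)
    (ms_swp_in_left hyC ha1.1 ha1.2.1 hc)

/-- shift the uncolored edge from `xy` to `yw` -/
lemma PC.shift (h : PC G D x y φ) {w : V} {β : ℕ} (hw : φ y w = β) (hβ : β ∈ ms D φ x) :
    PC G D w y (upd (upd φ x y β) y w 0) := by
  have hb := mem_ms.1 hβ
  have hwx : w ≠ x := by rintro rfl; rw [h.yx0] at hw; omega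
  have hxy : x ≠ y := h.adj.ne
  have hyw : y ≠ w := by rintro rfl; rw [h.self0] at hw; omega
  have hadj : G.Adj y w := h.adj' (by omega)
  have hs := h.symm
  refine ⟨hadj.symm, ?_, ?_, ?_, ?_⟩
  · intro u v; simp only [upd]; have := hs u v; grind
  · intro u v; simp only [upd]; have := h.le u v; grind
  · intro v p q
    have h1 := h.inj v p q
    have h2 := h.inj v p w
    have h3 := h.inj v q w
    have h4 := hb.2.2 p
    have h5 := hb.2.2 q
    simp only [upd]
    have h6 := hs y w
    have h7 := h.xy0
    have h8 := h.yx0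
    grind
  · intro u v
    have h1 := h.ne0 u v
    have h6 := hs y w
    have h9 := h.adj
    have h10 := h.adj.symm
    have h11 := hadj.symm
    simp only [upd]
    grind

lemma shift_ms_x {w : V} {β : ℕ} (hw : φ y w = β) (h : PC G D x y φ) (hβ : β ∈ ms D φ x) (c : ℕ) :
    c ∈ ms D (upd (upd φ x y β) y w 0) x ↔ c ∈ ms D φ x ∧ c ≠ β := by
  have hb := mem_ms.1 hβ
  have hwx : w ≠ x := by rintro rfl; rw [h.yx0] at hw; omega
  have hxy : x ≠ y := h.adj.ne
  simp only [mem_ms]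
  constructor
  · rintro ⟨h1, h2, h3⟩
    refine ⟨⟨h1, h2, fun v => ?_⟩, ?_⟩
    · have := h3 v
      have h7 := h.xy0
      simp only [upd] at this
      grind
    · have := h3 y
      simp only [upd] at this
      grind
  · rintro ⟨⟨h1, h2, h3⟩, h4⟩
    refine ⟨h1, h2, fun v => ?_⟩
    have := h3 v
    simp only [upd]
    grind

lemma shift_ms_y {w : V} {β : ℕ} (hw : φ y w = β) (h : PC G D x y φ) (hβ : β ∈ ms D φ x) (c : ℕ) :
    c ∈ ms D (upd (upd φ x y β) y w 0) y ↔ c ∈ ms D φ y := by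
  have hb := mem_ms.1 hβ
  have hwx : w ≠ x := by rintro rfl; rw [h.yx0] at hw; omega
  have hxy : x ≠ y := h.adj.ne
  have h7 := h.yx0
  simp only [mem_ms]
  constructor
  · rintro ⟨h1, h2, h3⟩
    refine ⟨h1, h2, fun v => ?_⟩
    have := h3 v
    have := h3 x
    simp only [upd] at *
    grind
  · rintro ⟨h1, h2, h3⟩
    refine ⟨h1, h2, fun v => ?_⟩
    have := h3 v
    have := h3 w
    simp only [upd]
    grind

lemma shift_ms_w {w : V} {β : ℕ} (hw : φ y w = β) (h : PC G D x y φ) (hβ : β ∈ ms D φ x) (c : ℕ) :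
    c ∈ ms D (upd (upd φ x y β) y w 0) w ↔ c ∈ ms D φ w ∨ c = β := by
  have hb := mem_ms.1 hβ
  have hwx : w ≠ x := by rintro rfl; rw [h.yx0] at hw; omega
  have hxy : x ≠ y := h.adj.ne
  have hyw : y ≠ w := by rintro rfl; rw [h.self0] at hw; omega
  have h7 := h.yx0
  have hs := h.symm w y
  have hi := fun v => h.inj w v y
  simp only [mem_ms]
  constructor
  · rintro ⟨h1, h2, h3⟩
    by_cases hc : c = β
    · exact Or.inr hc
    · refine Or.inl ⟨h1, h2, fun v => ?_⟩
      have := h3 v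
      simp only [upd] at *
      grind
  · rintro (⟨h1, h2, h3⟩ | rfl)
    · refine ⟨h1, h2, fun v => ?_⟩
      have := h3 v
      simp only [upd]
      grind
    · refine ⟨hb.1, hb.2.1, fun v => ?_⟩
      have := hi v
      simp only [upd]
      grind

lemma shift_other {w : V} {β : ℕ} (hw : φ y w = β) (h : PC G D x y φ) {c : ℕ}
    (h0 : c ≠ 0) (h1 : c ≠ β) (u v : V) :
    upd (upd φ x y β) y w 0 u v = c ↔ φ u v = c := by
  have h7 := h.yx0
  have h8 := h.xy0
  have hs := h.symm w y
  simp only [upd]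
  grind

lemma KG_congr {φ ψ : V → V → ℕ} {a b : ℕ} (ha : ∀ u v, ψ u v = a ↔ φ u v = a)
    (hb : ∀ u v, ψ u v = b ↔ φ u v = b) : KG ψ a b = KG φ a b := by
  ext u v; simp only [KG, SimpleGraph.fromRel_adj, ha, hb]

lemma R_congr {φ ψ : V → V → ℕ} {a b : ℕ} {p q : V} (ha : ∀ u v, ψ u v = a ↔ φ u v = a)
    (hb : ∀ u v, ψ u v = b ↔ φ u v = b) : R ψ a b p q ↔ R φ a b p q := by
  unfold R; rw [KG_congr ha hb]

end basics

set_option linter.unusedSectionVars false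

section basics2
variable {V : Type*} [Fintype V] {G : SimpleGraph V} [DecidableRel G.Adj] {D : ℕ} {x y : V}
  {φ : V → V → ℕ}

/-- The facts about critical graphs that are used. -/
structure Cr (G : SimpleGraph V) [DecidableRel G.Adj] (D : ℕ) : Prop where
  no : NoFull G D
  deg : ∀ v, G.degree v ≤ D
  ex : ∀ x y, G.Adj x y → ∃ φ, PC G D x y φ

lemma cr_of_critical (hG : IsDeltaCritical G) (hpos : 0 < G.maxDegree) : Cr G G.maxDegree := by
  refine ⟨?_, G.degree_le_maxDegree, ?_⟩
  · intro ψ hψ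
    have h1 := hG.2.1
    have h2 : chromIndex G ≤ G.maxDegree := Nat.sInf_le ⟨ψ, hψ⟩
    omega
  · intro x y hxy
    have h1 := hG.2.2 s(x, y) hxy
    have hne : {k | ∃ φ : V → V → ℕ, IsEdgeColoring (G.deleteEdges {s(x, y)}) k φ}.Nonempty := by
      by_contra hh
      rw [Set.not_nonempty_iff_eq_empty] at hh
      unfold chromIndex at h1
      rw [hh] at h1
      simp at h1
      omega
    have h2 := Nat.sInf_mem hne
    rw [show sInf {k | ∃ φ : V → V → ℕ, IsEdgeColoring (G.deleteEdges {s(x, y)}) k φ}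
      = G.maxDegree from h1] at h2
    obtain ⟨φ, hs, hr, hp⟩ := h2
    classical
    have hadj : ∀ u v, (G.deleteEdges {s(x, y)}).Adj u v ↔
        G.Adj u v ∧ ¬(u = x ∧ v = y) ∧ ¬(u = y ∧ v = x) := by
      intro u v
      simp only [SimpleGraph.deleteEdges_adj, Set.mem_singleton_iff, Sym2.eq_iff]
      tauto
    refine ⟨fun u v => if (G.deleteEdges {s(x, y)}).Adj u v then φ u v else 0, hxy, ?_, ?_, ?_, ?_⟩
    · intro u v
      simp only [SimpleGraph.adj_comm _ u v, hs u v]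
    · intro u v
      by_cases h : (G.deleteEdges {s(x, y)}).Adj u v
      · have := hr h; simp at this; simp only [h, if_true]; omega
      · simp only [h, if_false]; omega
    · intro v a b e hne
      by_cases h : (G.deleteEdges {s(x, y)}).Adj v a
      · by_cases h' : (G.deleteEdges {s(x, y)}).Adj v b
        · simp only [h, h', if_true] at e
          by_contra hab
          exact hp h h' hab e
        · simp only [h, h', if_true, if_false] at e hne
          omega
      · simp only [h, if_false] at hne; omega
    · intro u v
      rw [← hadj]
      by_cases h : (G.deleteEdges {s(x, y)}).Adj u v
      · have := hr h; simp at this; simp only [h, if_true]; simp; omega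
      · simp only [h, if_false]; simp

lemma PC.card_ms (h : PC G D x y φ) [DecidableEq V] (v : V) :
    (ms D φ v).card + G.degree v = D + (if v = x ∨ v = y then 1 else 0) := by
  have hxy := h.adj.ne
  have h1 : ms D φ v = Finset.Icc 1 D \ ((G.neighborFinset v).filter (fun w => φ v w ≠ 0)).image (φ v) := by
    ext c
    simp only [mem_ms, Finset.mem_sdiff, Finset.mem_Icc, Finset.mem_image, Finset.mem_filter,
      SimpleGraph.mem_neighborFinset]
    constructor
    · rintro ⟨h1, h2, h3⟩
      refine ⟨⟨h1, h2⟩, ?_⟩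
      rintro ⟨w, _, hw⟩
      exact h3 w hw
    · rintro ⟨⟨h1, h2⟩, h3⟩
      refine ⟨h1, h2, fun w hw => h3 ⟨w, ⟨h.adj' (by omega), by omega⟩, hw⟩⟩
  have h2 : (((G.neighborFinset v).filter (fun w => φ v w ≠ 0)).image (φ v)).card
      = ((G.neighborFinset v).filter (fun w => φ v w ≠ 0)).card := by
    apply Finset.card_image_of_injOn
    intro a ha b hb e
    simp at ha hb
    exact h.inj v a b e ha.2
  have h3 : ((G.neighborFinset v).filter (fun w => φ v w ≠ 0)).image (φ v) ⊆ Finset.Icc 1 D := by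
    intro c hc
    simp at hc
    obtain ⟨w, ⟨_, h2⟩, h3⟩ := hc
    have := h.le v w
    simp; omega
  have h4 := Finset.card_sdiff_add_card_eq_card h3
  rw [← h1, h2] at h4
  simp only [Nat.card_Icc, Nat.add_sub_cancel] at h4
  have h5 : ((G.neighborFinset v).filter (fun w => φ v w ≠ 0)).card + (if v = x ∨ v = y then 1 else 0)
      = G.degree v := by
    rw [← SimpleGraph.card_neighborFinset_eq_degree]
    rw [← Finset.card_filter_add_card_filter_not (s := G.neighborFinset v) (fun w => φ v w ≠ 0)]
    congr 1
    split_ifs with hv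
    · rcases hv with rfl | rfl
      · symm; rw [Finset.card_eq_one]
        refine ⟨y, ?_⟩
        ext w
        have := h.ne0 v w
        have h6 := h.adj
        have h7 := h.xy0
        simp only [Finset.mem_filter, SimpleGraph.mem_neighborFinset, Finset.mem_singleton]
        grind
      · symm; rw [Finset.card_eq_one]
        refine ⟨x, ?_⟩
        ext w
        have := h.ne0 v w
        have h6 := h.adj.symm
        have h7 := h.yx0
        simp only [Finset.mem_filter, SimpleGraph.mem_neighborFinset, Finset.mem_singleton]
        grind
    · symm; rw [Finset.card_eq_zero]
      ext w
      have := h.ne0 v w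
      simp only [Finset.mem_filter, SimpleGraph.mem_neighborFinset, Finset.notMem_empty]
      grind
  omega

lemma PC.card_ms_x (h : PC G D x y φ) : (ms D φ x).card + G.degree x = D + 1 := by
  classical
  have := h.card_ms x
  simpa using this

lemma PC.card_ms_y (h : PC G D x y φ) : (ms D φ y).card + G.degree y = D + 1 := by
  classical
  have := h.card_ms y
  simpa using this

lemma PC.card_ms_ge (h : PC G D x y φ) (v : V) : D ≤ (ms D φ v).card + G.degree v := by
  classical
  have := h.card_ms v
  omega

lemma PC.ex_y (h : PC G D x y φ) (hc : Cr G D) : ∃ c, c ∈ ms D φ y := by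
  have h1 := h.card_ms_y
  have h2 := hc.deg y
  exact Finset.card_pos.1 (by omega)

/-- F2 -/
lemma PC.F2 (h : PC G D x y φ) (hc : Cr G D) {w : V} (hw : φ y w ∈ ms D φ x) {η : ℕ}
    (h1 : η ∈ ms D φ x) (h2 : η ∈ ms D φ w) : False := by
  obtain ⟨γ, hγ⟩ := h.ex_y hc
  set β := φ y w with hβ
  have hb := mem_ms.1 hw
  have he := mem_ms.1 h1
  have he' := mem_ms.1 h2
  have hg := mem_ms.1 hγ
  have hγβ : γ ≠ β := by
    rintro rfl; exact hg.2.2 w rfl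
  have hηβ : η ≠ β := by
    rintro rfl; exact he'.2.2 y (h.symm w y)
  have hwx : w ≠ x := by rintro rfl; rw [h.yx0] at hβ; omega
  have hyw : y ≠ w := by rintro rfl; rw [h.self0] at hβ; omega
  have f1 := (h.F1 hc.no h1 hγ).2
  have h' := h.shift rfl hw
  have f2 := (h'.F1 hc.no (a := η) (c := γ) ((shift_ms_w rfl h hw η).2 (Or.inl h2))
    ((shift_ms_y rfl h hw γ).2 hγ)).2
  rw [R_congr (shift_other rfl h (by omega) hηβ) (shift_other rfl h (by omega) hγβ)] at f2
  exact h.three_ends he.1 hg.1 h.adj.ne.symm hyw hwx.symm (Or.inr hγ) (Or.inl h1) (Or.inl h2)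
    (SimpleGraph.Reachable.symm f1) (SimpleGraph.Reachable.symm f2)

/-- F3 -/
lemma PC.F3 (h : PC G D x y φ) (hc : Cr G D) {w : V} (hw : φ y w ≠ 0) {α α' : ℕ} (hne : α ≠ α')
    (h1 : α ∈ ms D φ x) (h2 : α ∈ ms D φ w) (h1' : α' ∈ ms D φ x) (hbmem : α' ∈ ms D φ w) :
    R φ α (φ y w) x w := by
  by_contra hR
  set β := φ y w with hβ
  have ha := mem_ms.1 h1
  have ha2 := mem_ms.1 h2
  have hle := h.le y w
  have hb : 1 ≤ β := by omega
  set C := comp φ α β w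
  have hC : KC φ α β C := h.kc_comp ha.1 hb w
  have hxC : x ∉ C := fun hh => hR (SimpleGraph.Reachable.symm hh)
  have hwC : w ∈ C := SimpleGraph.Reachable.refl w
  have hyC : y ∈ C := hC w y (Or.inr (h.symm w y)) hwC
  have h' := h.kswap ha.1 hb ha.2.1 hle hC
  have hα'β : α' ≠ β := by
    rintro rfl; exact (mem_ms.1 hbmem).2.2 y (h.symm w y)
  apply h'.F2 hc (w := w) (η := α')
  · rw [swp_in hyC, ← hβ, Equiv.swap_apply_right, ms_swp_out hxC]; exact h1
  · rw [ms_swp_out hxC]; exact h1'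
  · rw [ms_swp_other hne.symm hα'β]; exact hbmem

/-- direct move -/
lemma PC.direct (h : PC G D x y φ) {z : V} {γ : ℕ} (hγ : γ ∈ ms D φ y) (hz : φ x z = γ) :
    ∃ φ', PC G D x z φ' ∧ (∀ c, c ∈ ms D φ' x ↔ c ∈ ms D φ x) ∧ γ ∈ ms D φ' z ∧
      ∀ c, c ≠ 0 → c ≠ γ → ∀ u v, φ' u v = c ↔ φ u v = c := by
  have h' := h.swapEnds
  refine ⟨_, (h'.shift hz hγ).swapEnds, fun c => shift_ms_y hz h' hγ c,
    (shift_ms_w hz h' hγ γ).2 (Or.inr rfl), fun c h0 h1 u v => shift_other hz h' h0 h1 u v⟩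

lemma PC.recolor (h : PC G D x y φ) {w : V} {γ : ℕ} (hw : φ y w ≠ 0) (hγ : γ ∈ ms D φ y)
    (hγ' : γ ∈ ms D φ w) : PC G D x y (upd φ y w γ) := by
  have hg := mem_ms.1 hγ
  have hg' := mem_ms.1 hγ'
  have hs := h.symm
  refine ⟨h.adj, ?_, ?_, ?_, ?_⟩
  · intro u v; simp only [upd]; have := hs u v; grind
  · intro u v; simp only [upd]; have := h.le u v; grind
  · intro v p q
    have h1 := h.inj v p q
    have h2 := hg.2.2 p
    have h3 := hg.2.2 q
    have h4 := hg'.2.2 p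
    have h5 := hg'.2.2 q
    simp only [upd]
    grind
  · intro u v
    have h1 := h.ne0 u v
    have h2 := (h.ne0 y w).1 hw
    have h3 := h2.1.symm
    simp only [upd]
    grind

/-- the main move -/
lemma PC.move (h : PC G D x y φ) (hc : Cr G D) {w z : V} {α γ : ℕ} (hγ : γ ∈ ms D φ y)
    (hw : φ y w ≠ 0) (hα : α ∈ ms D φ x) (hαw : α ∈ ms D φ w) (hz : φ x z = φ y w) :
    ∃ φ', PC G D x z φ' ∧ (∀ c, c ∈ ms D φ' x ↔ c ∈ ms D φ x) ∧ φ y w ∈ ms D φ' z ∧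
      ∀ c, c ≠ 0 → c ≠ α → c ≠ γ → c ≠ φ y w → ∀ u v, φ' u v = c ↔ φ u v = c := by
  set β := φ y w with hβ
  have ha := mem_ms.1 hα
  have ha' := mem_ms.1 hαw
  have hg := mem_ms.1 hγ
  have hle := h.le y w
  have hwx : w ≠ x := by rintro rfl; rw [h.yx0] at hβ; omega
  have hyw : y ≠ w := by rintro rfl; rw [h.self0] at hβ; omega
  have hxy := h.adj.ne
  have f1 := h.F1 hc.no hα hγ
  have hβα : β ≠ α := fun e => ha'.2.2 y (by rw [h.symm]; exact e)
  have hβγ : β ≠ γ := fun e => hg.2.2 w e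
  set C := comp φ α γ w with hCd
  have hC : KC φ α γ C := h.kc_comp ha.1 hg.1 w
  have hxC : x ∉ C := fun hh => h.three_ends ha.1 hg.1 hxy hwx.symm hyw (Or.inl hα) (Or.inr hγ)
    (Or.inl hαw) f1.2 (SimpleGraph.Reachable.symm hh)
  have hyC : y ∉ C := fun hh => hxC (SimpleGraph.Reachable.trans hh (SimpleGraph.Reachable.symm f1.2))
  have hwC : w ∈ C := SimpleGraph.Reachable.refl w
  have h1 := h.kswap ha.1 hg.1 ha.2.1 hg.2.1 hC
  set φ1 := swp φ α γ C with hφ1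
  have e1 : φ1 y w = β := by rw [hφ1, swp_out hyC]
  have hg1 : γ ∈ ms D φ1 y := by rw [hφ1, ms_swp_out hyC]; exact hγ
  have hg2 : γ ∈ ms D φ1 w := ms_swp_in_right hwC hg.1 hg.2.1 hαw
  have h2 := h1.recolor (w := w) (by omega) hg1 hg2
  have hzw : z ≠ w := by
    rintro rfl
    exact hxy (h.inj z x y (by rw [h.symm, hz, h.symm z y]) (by rw [h.symm, hz]; exact hw))
  have hzx : z ≠ x := by
    rintro rfl; rw [h.self0] at hz; omega
  have hzy : z ≠ y := by
    rintro rfl; rw [h.xy0] at hz; omega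
  have e2 : upd φ1 y w γ x z = β := by
    rw [upd_ne (by tauto), hφ1, swp_out hxC, hz]
  have hβy : β ∈ ms D (upd φ1 y w γ) y := by
    rw [mem_ms]
    refine ⟨by omega, hle, fun v => ?_⟩
    by_cases hv : v = w
    · subst hv; rw [upd_eq]; exact hβγ.symm
    · rw [upd_ne (by tauto)]
      intro e
      exact hv (h1.inj y v w (by rw [e, e1]) (by rw [e]; exact hw))
  obtain ⟨φ', p1, p2, p3, p4⟩ := h2.direct hβy e2
  refine ⟨φ', p1, fun c => ?_, p3, fun c c0 c1 c2 c3 u v => ?_⟩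
  · rw [p2, mem_ms, ← ms_swp_out (φ := φ) (a := α) (b := γ) hxC, ← hφ1, mem_ms]
    have : ∀ v, upd φ1 y w γ x v = φ1 x v := fun v => upd_ne (by tauto)
    simp only [this]
  · rw [p4 c c0 c3]
    rw [← swp_other (φ := φ) (C := C) c1 c2, ← hφ1]
    have := h1.symm w y
    simp only [upd]
    grind

/-- component of x swap : `Mod` -/
lemma PC.modx (h : PC G D x y φ) {α ε : ℕ} (hα : α ∈ ms D φ x) (hε : 1 ≤ ε)
    (hε' : ε ≤ D) : ∃ φ' : V → V → ℕ, PC G D x y φ' ∧ (∀ c, c ≠ α → c ≠ ε →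
      ∀ u v, φ' u v = c ↔ φ u v = c) ∧ ε ∈ ms D φ' x ∧
      ∃ p : V, ∀ v, v ≠ x → v ≠ p → (α ∈ ms D φ v → α ∈ ms D φ' v) ∧
        (ε ∈ ms D φ v → ε ∈ ms D φ' v) := by
  have ha := mem_ms.1 hα
  set C := comp φ α ε x with hCd
  have hC : KC φ α ε C := h.kc_comp ha.1 hε x
  have hxC : x ∈ C := SimpleGraph.Reachable.refl x
  refine ⟨swp φ α ε C, h.kswap ha.1 hε ha.2.1 hε' hC, fun c c1 c2 u v => swp_other c1 c2,
    ms_swp_in_right hxC hε hε' hα, ?_⟩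
  by_cases hp : ∃ p ∈ C, p ≠ x ∧ (α ∈ ms D φ p ∨ ε ∈ ms D φ p)
  · obtain ⟨p, hpC, hpx, hp⟩ := hp
    refine ⟨p, fun v hvx hvp => ?_⟩
    by_cases hv : α ∈ ms D φ v ∨ ε ∈ ms D φ v
    · have hvC : v ∉ C := fun hvC =>
        h.three_ends ha.1 hε hpx.symm hvx.symm hvp.symm (Or.inl hα) hp hv hpC hvC
      rw [ms_swp_out hvC]; exact ⟨id, id⟩
    · tauto
  · refine ⟨x, fun v hvx _ => ?_⟩
    have hvC : (α ∈ ms D φ v ∨ ε ∈ ms D φ v) → v ∉ C := fun h1 hvC => hp ⟨v, hvC, hvx, h1⟩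
    constructor
    · intro h1; rw [ms_swp_out (hvC (Or.inl h1))]; exact h1
    · intro h1; rw [ms_swp_out (hvC (Or.inr h1))]; exact h1

end basics2

set_option linter.unusedSectionVars false

section basics3
variable {V : Type*} [Fintype V] {G : SimpleGraph V} [DecidableRel G.Adj] {D : ℕ} {x y : V}
  {φ : V → V → ℕ}

lemma ms_congr {φ ψ : V → V → ℕ} {c : ℕ} (h : ∀ u v, ψ u v = c ↔ φ u v = c) (v : V) :
    c ∈ ms D ψ v ↔ c ∈ ms D φ v := by
  simp only [mem_ms, Ne, h]

lemma PC.disj (h : PC G D x y φ) (hc : Cr G D) (hk : G.degree x + 2 ≤ D) {w w' : V} (hne : w ≠ w')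
    (hw : φ y w ∈ ms D φ x) (hw' : φ y w' ∈ ms D φ x) {ε : ℕ} (h1 : ε ∈ ms D φ w)
    (h2 : ε ∈ ms D φ w') : False := by
  classical
  have hcard := h.card_ms_x
  have : ((ms D φ x) \ {φ y w, φ y w'}).Nonempty := by
    rw [← Finset.card_pos]
    have := Finset.le_card_sdiff {φ y w, φ y w'} (ms D φ x)
    have h2 := Finset.card_le_two (a := φ y w) (b := φ y w')
    omega
  obtain ⟨α, hα⟩ := this
  simp only [Finset.mem_sdiff, Finset.mem_insert, Finset.mem_singleton, not_or] at hα
  have hεx : ε ∉ ms D φ x := fun hh => h.F2 hc hw hh h1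
  have he := mem_ms.1 h1
  obtain ⟨φ', p1, p2, p3, p, p4⟩ := h.modx hα.1 he.1 he.2.1
  have n1 : φ y w ≠ ε := fun e => hεx (e ▸ hw)
  have n2 : φ y w' ≠ ε := fun e => hεx (e ▸ hw')
  have q1 := p2 (φ y w) (Ne.symm hα.2.1) n1
  have q2 := p2 (φ y w') (Ne.symm hα.2.2) n2
  have nx : w ≠ x := by rintro rfl; rw [h.yx0] at hw; have := (mem_ms.1 hw).1; omega
  have nx' : w' ≠ x := by rintro rfl; rw [h.yx0] at hw'; have := (mem_ms.1 hw').1; omega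
  by_cases hwp : w = p
  · have hwp' : w' ≠ p := by rintro rfl; exact hne hwp
    refine p1.F2 hc (w := w') ?_ p3 ((p4 w' nx' hwp').2 h2)
    rw [(q2 y w').2 rfl, ms_congr q2]; exact hw'
  · refine p1.F2 hc (w := w) ?_ p3 ((p4 w nx hwp).2 h1)
    rw [(q1 y w).2 rfl, ms_congr q1]; exact hw

lemma card_nonM (h : PC G D x y φ) : (Finset.Icc 1 D \ ms D φ x).card + 1 = G.degree x := by
  have h1 : ms D φ x ⊆ Finset.Icc 1 D := by
    intro c hc; have := mem_ms.1 hc; simp; omega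
  have h2 := Finset.card_sdiff_add_card_eq_card h1
  have h3 := h.card_ms_x
  have h5 : 0 < G.degree x := by
    rw [SimpleGraph.degree_pos_iff_exists_adj]; exact ⟨y, h.adj⟩
  simp at h2
  omega

/-- Weak Vizing adjacency statement, for a fixed coloring. -/
lemma PC.val [DecidableEq V] (h : PC G D x y φ) (hc : Cr G D) (hk : G.degree x + 2 ≤ D) :
    ((G.neighborFinset y).filter (fun w => φ y w ∉ ms D φ x)).card + 1 ≤ G.degree x ∧
    ∑ w ∈ (G.neighborFinset y).filter (fun w => φ y w ∈ ms D φ x), (D - G.degree w) + 1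
      ≤ G.degree x := by
  have hN := card_nonM h
  constructor
  · obtain ⟨γ, hγ⟩ := h.ex_y hc
    have hγ' := mem_ms.1 hγ
    have hsub : (((G.neighborFinset y).filter (fun w => φ y w ∉ ms D φ x)).erase x).image (φ y) ⊆
        (Finset.Icc 1 D \ ms D φ x).erase γ := by
      intro c hc'
      simp only [Finset.mem_image, Finset.mem_erase, Finset.mem_filter,
        SimpleGraph.mem_neighborFinset] at hc'
      obtain ⟨w, ⟨hwx, hadj, hw⟩, rfl⟩ := hc'
      have h1 := (h.ne0 y w).2 ⟨hadj, by have := h.adj.ne; grind, by tauto⟩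
      have h2 := h.le y w
      simp only [Finset.mem_erase, Finset.mem_sdiff, Finset.mem_Icc]
      exact ⟨hγ'.2.2 w, ⟨by omega, h2⟩, hw⟩
    have h1 := Finset.card_le_card hsub
    rw [Finset.card_image_of_injOn] at h1
    · have hmem : γ ∈ Finset.Icc 1 D \ ms D φ x := by
        simp only [Finset.mem_sdiff, Finset.mem_Icc]
        exact ⟨⟨hγ'.1, hγ'.2.1⟩, fun hh => h.no_common hc.no hh hγ⟩
      rw [Finset.card_erase_of_mem hmem] at h1
      have h2 := Finset.pred_card_le_card_erase (s := (G.neighborFinset y).filter (fun w => φ y w ∉ ms D φ x)) (a := x)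
      have := Finset.card_pos.2 ⟨γ, hmem⟩
      omega
    · intro a ha b hb e
      simp at ha hb
      have h1 := (h.ne0 y a).2 ⟨ha.1.1, by have := h.adj.ne; grind, by tauto⟩
      exact h.inj y a b e h1
  · have h1 : ∑ w ∈ (G.neighborFinset y).filter (fun w => φ y w ∈ ms D φ x), (D - G.degree w) ≤
        ∑ w ∈ (G.neighborFinset y).filter (fun w => φ y w ∈ ms D φ x), (ms D φ w).card := by
      apply Finset.sum_le_sum
      intro w _
      have := h.card_ms_ge w
      omega
    rw [← Finset.card_biUnion] at h1
    · have h2 : (Finset.biUnion ((G.neighborFinset y).filter (fun w => φ y w ∈ ms D φ x)) (ms D φ)) ⊆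
          Finset.Icc 1 D \ ms D φ x := by
        intro c hc'
        simp only [Finset.mem_biUnion, Finset.mem_filter] at hc'
        obtain ⟨w, ⟨_, hw⟩, hcw⟩ := hc'
        have := mem_ms.1 hcw
        simp only [Finset.mem_sdiff, Finset.mem_Icc]
        exact ⟨⟨this.1, this.2.1⟩, fun hh => h.F2 hc hw hh hcw⟩
      have := Finset.card_le_card h2
      omega
    · intro a ha b hb hab
      simp at ha hb
      rw [Function.onFun, Finset.disjoint_left]
      intro c h1 h2
      exact h.disj hc hk hab ha.2 hb.2 h1 h2

/-- Weak Vizing adjacency statement. -/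
lemma valw [DecidableEq V] (hc : Cr G D) (hxy : G.Adj x y) (hk : G.degree x + 2 ≤ D) :
    ∃ B ⊆ G.neighborFinset y, x ∈ B ∧ B.card + 1 ≤ G.degree x ∧
      ∑ w ∈ G.neighborFinset y \ B, (D - G.degree w) + 1 ≤ G.degree x := by
  obtain ⟨φ, h⟩ := hc.ex x y hxy
  obtain ⟨h1, h2⟩ := h.val hc hk
  refine ⟨_, Finset.filter_subset _ _, ?_, h1, ?_⟩
  · simp only [Finset.mem_filter, SimpleGraph.mem_neighborFinset, mem_ms, h.yx0]
    exact ⟨hxy.symm, by omega⟩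
  · convert h2 using 3
    ext w; simp; tauto

end basics3

set_option linter.unusedSectionVars false

section leaves
variable {V : Type*} [Fintype V] {G : SimpleGraph V} [DecidableRel G.Adj] {D : ℕ} {x y : V}
  {φ : V → V → ℕ}

lemma PC.card_nonms (h : PC G D x y φ) (v : V) :
    (Finset.Icc 1 D \ ms D φ v).card ≤ G.degree v := by
  have h1 : ms D φ v ⊆ Finset.Icc 1 D := by
    intro c hc; have := mem_ms.1 hc; simp; omega
  have h2 := Finset.card_sdiff_add_card_eq_card h1
  have h3 := h.card_ms_ge v
  simp at h2
  omega

lemma PC.choose2 (h : PC G D x y φ) (v v' : V) (F : Finset ℕ)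
    (hF : G.degree x + G.degree v + G.degree v' + F.card ≤ D) :
    ∃ α, α ∈ ms D φ x ∧ α ∈ ms D φ v ∧ α ∈ ms D φ v' ∧ α ∉ F := by
  have h1 := h.card_ms_x
  have h2 := h.card_nonms v
  have h3 := h.card_nonms v'
  have h4 := Finset.card_union_le (Finset.Icc 1 D \ ms D φ v) (Finset.Icc 1 D \ ms D φ v')
  have h5 := Finset.card_union_le ((Finset.Icc 1 D \ ms D φ v) ∪ (Finset.Icc 1 D \ ms D φ v')) F
  obtain ⟨α, ha, hb⟩ := Finset.exists_mem_notMem_of_card_lt_card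
    (s := ((Finset.Icc 1 D \ ms D φ v) ∪ (Finset.Icc 1 D \ ms D φ v')) ∪ F) (t := ms D φ x) (by omega)
  have h6 := mem_ms.1 ha
  simp only [Finset.mem_union, Finset.mem_sdiff, Finset.mem_Icc] at hb
  exact ⟨α, ha, by tauto⟩

lemma PC.choose1 (h : PC G D x y φ) (v : V) (F : Finset ℕ)
    (hF : G.degree x + G.degree v + F.card ≤ D) :
    ∃ α, α ∈ ms D φ x ∧ α ∈ ms D φ v ∧ α ∉ F := by
  have h1 := h.card_ms_x
  have h2 := h.card_nonms v
  have h4 := Finset.card_union_le (Finset.Icc 1 D \ ms D φ v) F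
  obtain ⟨α, ha, hb⟩ := Finset.exists_mem_notMem_of_card_lt_card
    (s := (Finset.Icc 1 D \ ms D φ v) ∪ F) (t := ms D φ x) (by omega)
  have h6 := mem_ms.1 ha
  simp only [Finset.mem_union, Finset.mem_sdiff, Finset.mem_Icc] at hb
  exact ⟨α, ha, by tauto⟩

/-- colors of a path -/
def cols (φ : V → V → ℕ) (γ : ℕ) (l : List (V × V)) : List ℕ :=
  γ :: l.map (fun p => φ p.1 p.2)

/-- exploration paths -/
inductive Pth (φ : V → V → ℕ) (x y : V) (γ : ℕ) (W : Finset V) : V → List (V × V) → Prop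
  | root : Pth φ x y γ W y []
  | dir (z : V) : φ x z = γ → Pth φ x y γ W z []
  | step (z v z' : V) (l : List (V × V)) : Pth φ x y γ W z l → v ∈ W → φ z v ≠ 0 →
      φ x z' = φ z v → φ z v ∉ cols φ γ l → Pth φ x y γ W z' ((z, v) :: l)

/-- color missing at the end of the path after shifting -/
def hd (φ : V → V → ℕ) (γ : ℕ) : List (V × V) → ℕ
  | [] => γ
  | (p :: _) => φ p.1 p.2

variable {γ : ℕ} {W : Finset V}

/-- degree conditions on `W` -/
structure WC (G : SimpleGraph V) [DecidableRel G.Adj] (D : ℕ) (x : V) (W : Finset V) : Prop where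
  nx : x ∉ W
  one : ∀ v ∈ W, G.degree v + 3 * G.degree x + 10 ≤ D
  two : ∀ v ∈ W, ∀ v' ∈ W, v ≠ v' → G.degree v + G.degree v' + 3 * G.degree x + 10 ≤ D

lemma WC.choose (hW : WC G D x W) (h : PC G D x y φ) {v v' : V} (hv : v ∈ W) (hv' : v' ∈ W)
    (F : Finset ℕ) (hF : F.card ≤ 2 * G.degree x + 10) :
    ∃ α, α ∈ ms D φ x ∧ α ∈ ms D φ v ∧ α ∈ ms D φ v' ∧ α ∉ F := by
  by_cases e : v = v'
  · subst e
    have := hW.one v hv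
    obtain ⟨α, h1, h2, h3⟩ := h.choose1 v F (by omega)
    exact ⟨α, h1, h2, h2, h3⟩
  · have := hW.two v hv v' hv' e
    exact h.choose2 v v' F (by omega)

lemma Pth.cols_sub (h : PC G D x y φ) (hc : Cr G D) (hγ : γ ∈ ms D φ y) {z : V}
    {l : List (V × V)} (hp : Pth φ x y γ W z l) :
    (cols φ γ l).Nodup ∧ ∀ c ∈ cols φ γ l, c ∈ Finset.Icc 1 D \ ms D φ x := by
  have h0 : γ ∈ Finset.Icc 1 D \ ms D φ x := by
    have := mem_ms.1 hγ
    simp only [Finset.mem_sdiff, Finset.mem_Icc]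
    exact ⟨by omega, fun hh => h.no_common hc.no hh hγ⟩
  induction hp with
  | root => simpa [cols] using h0
  | dir z hz => simpa [cols] using h0
  | step z v z' l _ _ h1 h2 h3 ih =>
    simp only [cols, List.map_cons, List.nodup_cons, List.mem_cons] at *
    refine ⟨?_, ?_⟩
    · tauto
    · rintro c (rfl | rfl | hc')
      · exact h0
      · have := h.le z v
        simp only [Finset.mem_sdiff, Finset.mem_Icc, mem_ms]
        refine ⟨by omega, fun hh => hh.2.2 z' h2⟩
      · exact ih.2 c (Or.inr hc')

lemma Pth.len (h : PC G D x y φ) (hc : Cr G D) (hγ : γ ∈ ms D φ y) {z : V}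
    {l : List (V × V)} (hp : Pth φ x y γ W z l) : l.length + 2 ≤ G.degree x := by
  classical
  obtain ⟨h1, h2⟩ := hp.cols_sub h hc hγ
  have h3 : (cols φ γ l).toFinset ⊆ Finset.Icc 1 D \ ms D φ x := by
    intro c hc'
    exact h2 c (by simpa using hc')
  have h4 := Finset.card_le_card h3
  rw [List.toFinset_card_of_nodup h1] at h4
  have h5 := card_nonM h
  simp [cols] at h4
  omega

lemma Pth.cols_card (h : PC G D x y φ) (hc : Cr G D) (hγ : γ ∈ ms D φ y) {z : V}
    {l : List (V × V)} (hp : Pth φ x y γ W z l) : (cols φ γ l).toFinset.card ≤ G.degree x := by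
  have h1 := hp.len h hc hγ
  have h2 := List.toFinset_card_le (cols φ γ l)
  simp [cols] at h2 ⊢
  omega

lemma Pth.hd_mem {l : List (V × V)} : hd φ γ l ∈ cols φ γ l := by
  cases l <;> simp [hd, cols]

lemma Pth.realize (h : PC G D x y φ) (hc : Cr G D) (hW : WC G D x W) (hγ : γ ∈ ms D φ y) {z : V}
    {l : List (V × V)} (hp : Pth φ x y γ W z l) (Fb : Finset ℕ)
    (hF : Fb.card + l.length ≤ 2 * G.degree x + 10) :
    ∃ (A : Finset ℕ) (φ' : V → V → ℕ), (∀ c ∈ Fb, c ∉ A) ∧ PC G D x z φ' ∧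
      (∀ c, c ∈ ms D φ' x ↔ c ∈ ms D φ x) ∧ hd φ γ l ∈ ms D φ' z ∧
      ∀ c, c ≠ 0 → c ∉ cols φ γ l → c ∉ A → ∀ u v, φ' u v = c ↔ φ u v = c := by
  classical
  induction hp generalizing Fb with
  | root => exact ⟨∅, φ, by simp, h, by simp, by simpa [hd] using hγ, by simp⟩
  | dir z hz =>
    obtain ⟨φ', p1, p2, p3, p4⟩ := h.direct hγ hz
    refine ⟨∅, φ', by simp, p1, p2, by simpa [hd] using p3, ?_⟩
    intro c c0 c1 _
    exact p4 c c0 (by simpa [cols] using c1)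
  | step z v z' l hp hv h1 h2 h3 ih =>
    have hcard := Finset.card_insert_le (φ z v) Fb
    simp only [List.length_cons] at hF
    obtain ⟨A, φ', p1, p2, p3, p4, p5⟩ := ih (insert (φ z v) Fb) (by omega)
    have e := p5 (φ z v) h1 h3 (p1 _ (by simp))
    have hvd := hW.one v hv
    obtain ⟨α, a1, a2, a3⟩ := p2.choose1 v Fb (by omega)
    have e1 : φ' z v = φ z v := (e z v).2 rfl
    have e2 : φ' x z' = φ' z v := by rw [e1]; exact (e x z').2 h2
    obtain ⟨ψ, q1, q2, q3, q4⟩ := p2.move hc p4 (by rw [e1]; exact h1) a1 a2 e2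
    refine ⟨insert α A, ψ, ?_, q1, ?_, ?_, ?_⟩
    · intro c hc'
      have := p1 c (by simp [hc'])
      simp only [Finset.mem_insert, not_or]
      exact ⟨fun e => a3 (e ▸ hc'), this⟩
    · intro c; rw [q2, p3]
    · rw [e1] at q3; exact q3
    · intro c c0 c1 c2
      simp only [cols, List.map_cons, List.mem_cons, not_or] at c1
      simp only [Finset.mem_insert, not_or] at c2
      have hl : c ∉ cols φ γ l := by simp only [cols, List.mem_cons, not_or]; tauto
      intro u w
      rw [q4 c c0 c2.1 (fun e => hl (e ▸ Pth.hd_mem)) (by rw [e1]; exact c1.2.1), p5 c c0 hl c2.2]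

lemma Pth.claimE (h : PC G D x y φ) (hc : Cr G D) (hW : WC G D x W) (hγ : γ ∈ ms D φ y) {z : V}
    {l : List (V × V)} (hp : Pth φ x y γ W z l) {v : V} (hv : v ∈ W) (h0 : φ z v ≠ 0)
    (h1 : φ z v ∉ cols φ γ l) {α : ℕ} (ha : α ∈ ms D φ x) (ha' : α ∈ ms D φ v)
    (ha2 : α ∉ cols φ γ l) : φ z v ∉ ms D φ x ∧ R φ α (φ z v) x v := by
  classical
  have hlen := hp.len h hc hγ
  have hcc := hp.cols_card h hc hγ
  have hci := Finset.card_insert_le α (cols φ γ l).toFinset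
  obtain ⟨α2, b1, b2, _, b3⟩ := hW.choose h hv hv (insert α (cols φ γ l).toFinset) (by omega)
  simp only [Finset.mem_insert, List.mem_toFinset, not_or] at b3
  have h3 := Finset.card_le_three (a := φ z v) (b := α) (c := α2)
  obtain ⟨A, φ', p1, p2, p3, p4, p5⟩ := hp.realize h hc hW hγ {φ z v, α, α2} (by omega)
  have e := p5 (φ z v) h0 h1 (p1 _ (by simp))
  have e1 := p5 α (by have := (mem_ms.1 ha).1; omega) ha2 (p1 _ (by simp))
  have e2 := p5 α2 (by have := (mem_ms.1 b1).1; omega) b3.2 (p1 _ (by simp))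
  have e3 : φ' z v = φ z v := (e z v).2 rfl
  have hav : α ∈ ms D φ' v := (ms_congr e1 v).2 ha'
  constructor
  · intro hh
    exact p2.F2 hc (w := v) (η := α) (by rw [e3, p3]; exact hh) ((p3 α).2 ha) hav
  · have := p2.F3 hc (w := v) (by rw [e3]; exact h0) (Ne.symm b3.1) ((p3 α).2 ha) hav
      ((p3 α2).2 b1) ((ms_congr e2 v).2 b2)
    rw [e3, R_congr e1 e] at this
    exact this

lemma Pth.initSeg {z : V} {l : List (V × V)} (hp : Pth φ x y γ W z l) {z0 v0 : V}
    (hm : (z0, v0) ∈ l) : ∃ l0, l0.length < l.length ∧ Pth φ x y γ W z0 l0 ∧ v0 ∈ W ∧ φ z0 v0 ≠ 0 ∧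
      φ z0 v0 ∉ cols φ γ l0 ∧ ∀ c, c ∈ cols φ γ l0 → c ∈ cols φ γ l := by
  induction hp with
  | root => simp at hm
  | dir z hz => simp at hm
  | step z v z' l hp hv h1 h2 h3 ih =>
    rcases List.mem_cons.1 hm with e | hm
    · obtain ⟨rfl, rfl⟩ := Prod.mk.inj e
      refine ⟨l, by simp, hp, hv, h1, h3, ?_⟩
      intro c hc; simp [cols] at *; tauto
    · obtain ⟨l0, a1, a2, a3, a4, a5, a6⟩ := ih hm
      refine ⟨l0, by simp; omega, a2, a3, a4, a5, ?_⟩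
      intro c hc; have := a6 c hc; simp [cols] at *; tauto

lemma cols_congr {ψ : V → V → ℕ} {l : List (V × V)} (h : ∀ p ∈ l, ψ p.1 p.2 = φ p.1 p.2) :
    cols ψ γ l = cols φ γ l := by
  unfold cols
  rw [List.map_congr_left h]

lemma Pth.persist {ψ : V → V → ℕ} {z : V} {l : List (V × V)} (hp : Pth φ x y γ W z l)
    (hx : ∀ v, ψ x v = φ x v) (h : ∀ p ∈ l, ψ p.1 p.2 = φ p.1 p.2) : Pth ψ x y γ W z l := by
  induction hp with
  | root => exact Pth.root
  | dir z hz => exact Pth.dir z (by rw [hx]; exact hz)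
  | step z v z' l hp hv h1 h2 h3 ih =>
    have e : ψ z v = φ z v := h (z, v) (by simp)
    have hl : ∀ p ∈ l, ψ p.1 p.2 = φ p.1 p.2 := fun p hp => h p (by simp [hp])
    refine Pth.step z v z' l (ih hl) hv (by rw [e]; exact h1) (by rw [hx, e]; exact h2) ?_
    rw [e, cols_congr hl]; exact h3

lemma Pth.swap_contra (h : PC G D x y φ) (hc : Cr G D) (hW : WC G D x W) (hγ : γ ∈ ms D φ y) {z : V}
    {l : List (V × V)} (hp : Pth φ x y γ W z l) {v u : V} (hv : v ∈ W) (h0 : φ z v ≠ 0)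
    {α : ℕ} (ha : α ∈ ms D φ x) (ha' : α ∈ ms D φ v) (ha2 : α ∉ cols φ γ l)
    (hux : x ≠ u) (huv : u ≠ v) (hu : α ∈ ms D φ u ∨ φ z v ∈ ms D φ u) (hR : R φ α (φ z v) x u)
    (hy : y = u ∨ γ ≠ φ z v)
    (hl : ∀ p ∈ l, φ p.1 p.2 = φ z v → p.2 = u) : False := by
  classical
  have hδ := h.le z v
  have hxv : x ≠ v := fun e => hW.nx (e ▸ hv)
  have hα := mem_ms.1 ha
  set δ := φ z v with hδd
  set C := comp φ α δ v with hCd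
  have hC : KC φ α δ C := h.kc_comp hα.1 (by omega) v
  have hxC : x ∉ C := fun hh => h.three_ends hα.1 (by omega) hux hxv huv (Or.inl ha) hu (Or.inl ha')
    hR (SimpleGraph.Reachable.symm hh)
  have huC : u ∉ C := fun hh => hxC (SimpleGraph.Reachable.trans hh (SimpleGraph.Reachable.symm hR))
  have hvC : v ∈ C := SimpleGraph.Reachable.refl v
  have h' := h.kswap hα.1 (by omega) hα.2.1 hδ hC
  have hll : ∀ p ∈ l, swp φ α δ C p.1 p.2 = φ p.1 p.2 := by
    intro p hp'
    by_cases e : φ p.1 p.2 = δ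
    · have := hl p hp' e
      rw [h'.symm, this, swp_out huC, h.symm]
    · rw [swp_other (c := φ p.1 p.2) _ e]
      intro e2
      apply ha2
      simp only [cols, List.mem_cons, List.mem_map]
      exact Or.inr ⟨p, hp', e2⟩
  have hp' := hp.persist (ψ := swp φ α δ C) (fun w => swp_out hxC) hll
  have hγ' : γ ∈ ms D (swp φ α δ C) y := by
    rcases hy with rfl | hy
    · rw [ms_swp_out huC]; exact hγ
    · rw [ms_swp_other _ hy]; · exact hγ
      rintro rfl; exact ha2 (by simp [cols])
  have e1 : swp φ α δ C z v = α := by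
    rw [h'.symm, swp_in hvC, h.symm, ← hδd, Equiv.swap_apply_right]
  have hcc := hp'.cols_card h' hc hγ'
  obtain ⟨α2, b1, b2, _, b3⟩ := hW.choose h' hv hv (cols (swp φ α δ C) γ l).toFinset (by omega)
  have := hp'.claimE h' hc hW hγ' hv (by rw [e1]; omega) (by rw [e1, cols_congr hll]; exact ha2)
    b1 b2 (by simpa using b3)
  apply this.1
  rw [e1, ms_swp_out hxC]; exact ha

lemma Pth.fresh (h : PC G D x y φ) (hc : Cr G D) (hW : WC G D x W) (hγ : γ ∈ ms D φ y) {z : V}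
    {l : List (V × V)} (hp : Pth φ x y γ W z l) (hmin : ∀ l', Pth φ x y γ W z l' → l.length ≤ l'.length)
    {v : V} (hv : v ∈ W) (h0 : φ z v ≠ 0) : φ z v ∉ cols φ γ l := by
  classical
  intro hmem
  have hnd := (hp.cols_sub h hc hγ).1
  have hcc := hp.cols_card h hc hγ
  have hg := mem_ms.1 hγ
  rw [cols, List.nodup_cons] at hnd
  have hmem' := hmem
  simp only [cols, List.mem_cons, List.mem_map] at hmem'
  rcases hmem' with e | ⟨⟨z0, v0⟩, hm, e⟩
  · obtain ⟨α, a1, a2, _, a3⟩ := hW.choose h hv hv (cols φ γ l).toFinset (by omega)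
    have f1 := h.F1 hc.no a1 hγ
    refine hp.swap_contra h hc hW hγ hv h0 a1 a2 (by simpa using a3) (u := y) h.adj.ne ?_ ?_ ?_
      (Or.inl rfl) ?_
    · rintro rfl; exact hg.2.2 z (by rw [h.symm]; exact e)
    · rw [e]; exact Or.inr hγ
    · rw [e]; exact f1.2
    · intro p hp' e2
      exact absurd (List.mem_map.2 ⟨p, hp', e2.trans e⟩) hnd.1
  · simp only at e
    obtain ⟨l0, b1, b2, b3, b4, b5, b6⟩ := hp.initSeg hm
    obtain ⟨α, a1, a2, a2', a3⟩ := hW.choose h hv b3 (cols φ γ l).toFinset (by omega)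
    have a3' : α ∉ cols φ γ l := by simpa using a3
    have f := (b2.claimE h hc hW hγ b3 b4 b5 a1 a2' (fun hh => a3' (b6 _ hh))).2
    rw [e] at f
    refine hp.swap_contra h hc hW hγ hv h0 a1 a2 a3' (u := v0) ?_ ?_ (Or.inl a2') f
      (Or.inr ?_) ?_
    · rintro rfl; exact hW.nx b3
    · rintro rfl
      have : z = z0 := h.inj v0 z z0 (by rw [h.symm, ← e, h.symm]) (by rw [h.symm]; exact h0)
      subst this
      have := hmin l0 b2
      omega
    · rintro rfl
      apply b5; rw [e]; simp [cols]
    · intro p hp' e2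
      have := List.inj_on_of_nodup_map hnd.2 hp' hm (by simp only; rw [e2, e])
      rw [this]

lemma Pth.exmin {z : V} {l : List (V × V)} (hp : Pth φ x y γ W z l) :
    ∃ l, Pth φ x y γ W z l ∧ ∀ l', Pth φ x y γ W z l' → l.length ≤ l'.length := by
  classical
  have hex : ∃ n, ∃ l, Pth φ x y γ W z l ∧ l.length = n := ⟨_, l, hp, rfl⟩
  obtain ⟨l1, h1, h2⟩ := Nat.find_spec hex
  refine ⟨l1, h1, fun l' hl' => ?_⟩
  rw [h2]
  exact Nat.find_min' hex ⟨l', hl', rfl⟩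

lemma Pth.fresh' (h : PC G D x y φ) (hc : Cr G D) (hW : WC G D x W) (hγ : γ ∈ ms D φ y) {z : V}
    {l0 : List (V × V)} (hp0 : Pth φ x y γ W z l0) :
    ∃ l, Pth φ x y γ W z l ∧ ∀ v ∈ W, φ z v ≠ 0 → φ z v ∉ cols φ γ l := by
  obtain ⟨l, h1, h2⟩ := hp0.exmin
  exact ⟨l, h1, fun v hv h0 => h1.fresh h hc hW hγ h2 hv h0⟩

lemma Pth.inj2 (h : PC G D x y φ) (hc : Cr G D) (hW : WC G D x W) (hγ : γ ∈ ms D φ y) {z z' : V}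
    {l l' : List (V × V)} (hp : Pth φ x y γ W z l) (hp' : Pth φ x y γ W z' l')
    {v v' : V} (hv : v ∈ W) (hv' : v' ∈ W) (h0 : φ z v ≠ 0) (e : φ z v = φ z' v') :
    z = z' ∧ v = v' := by
  classical
  obtain ⟨l, h1, h2⟩ := hp.fresh' h hc hW hγ
  obtain ⟨l', h1', h2'⟩ := hp'.fresh' h hc hW hγ
  have hv0 : v = v' := by
    by_contra hne
    have c1 := h1.cols_card h hc hγ
    have c2 := h1'.cols_card h hc hγ
    have c3 := Finset.card_union_le (cols φ γ l).toFinset (cols φ γ l').toFinset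
    obtain ⟨α, a1, a2, a3, a4⟩ := hW.choose h hv hv' ((cols φ γ l).toFinset ∪ (cols φ γ l').toFinset)
      (by omega)
    simp only [Finset.mem_union, List.mem_toFinset, not_or] at a4
    have f1 := (h1.claimE h hc hW hγ hv h0 (h2 v hv h0) a1 a2 a4.1).2
    have f2 := (h1'.claimE h hc hW hγ hv' (e ▸ h0) (h2' v' hv' (e ▸ h0)) a1 a3 a4.2).2
    rw [← e] at f2
    have nx1 : x ≠ v := fun e => hW.nx (e ▸ hv)
    have nx2 : x ≠ v' := fun e => hW.nx (e ▸ hv')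
    exact h.three_ends (mem_ms.1 a1).1 (by omega) nx1 nx2
      hne (Or.inl a1) (Or.inl a2) (Or.inl a3) f1 f2
  subst hv0
  exact ⟨h.inj v z z' (by rw [h.symm, e, h.symm]) (by rw [h.symm]; exact h0), rfl⟩

lemma PC.ex_edge (h : PC G D x y φ) {c : ℕ} (h1 : 1 ≤ c) (h2 : c ≤ D) (h3 : c ∉ ms D φ x) :
    ∃ z, φ x z = c := by
  by_contra hh
  push Not at hh
  exact h3 (mem_ms.2 ⟨h1, h2, hh⟩)

theorem leaves [DecidableEq V] (hc : Cr G D) (hW : WC G D x W) (hxy : G.Adj x y) :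
    (W.filter (fun v => G.Adj y v)).card + 1 ≤
      ((G.neighborFinset x).filter (fun z => z ≠ y ∧ ∀ v ∈ W, ¬ G.Adj z v)).card := by
  classical
  obtain ⟨φ, h⟩ := hc.ex x y hxy
  obtain ⟨γ, hγ⟩ := h.ex_y hc
  have hg := mem_ms.1 hγ
  set T : Finset V := Finset.univ.filter (fun z => ∃ l, Pth φ x y γ W z l) with hT
  have hTN : ∀ z ∈ T, G.Adj x z := by
    intro z hz
    simp only [hT, Finset.mem_filter, Finset.mem_univ, true_and] at hz
    obtain ⟨l, hl⟩ := hz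
    cases hl with
    | root => exact hxy
    | dir _ hz => exact h.adj' (by omega)
    | step z v _ l _ _ h1 h2 _ => exact h.adj' (by rw [h2]; exact h1)
  have hγM : γ ∉ ms D φ x := fun hh => h.no_common hc.no hh hγ
  obtain ⟨zg, hzg⟩ := h.ex_edge hg.1 hg.2.1 hγM
  have hzgT : zg ∈ T := by simp only [hT, Finset.mem_filter, Finset.mem_univ, true_and]; exact ⟨_, Pth.dir zg hzg⟩
  have hyT : y ∈ T := by simp only [hT, Finset.mem_filter, Finset.mem_univ, true_and]; exact ⟨_, Pth.root⟩
  have hne0 : ∀ z ∈ T, ∀ v ∈ W, G.Adj z v → φ z v ≠ 0 := by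
    intro z hz v hv hadj
    rw [h.ne0]
    have h1 := (hTN z hz).ne
    have h2 : v ≠ x := fun e => hW.nx (e ▸ hv)
    exact ⟨hadj, by tauto, by tauto⟩
  have hyzg : y ≠ zg := by rintro rfl; rw [h.xy0] at hzg; omega
  set P : Finset (Σ _ : V, V) := T.sigma (fun z => W.filter (fun v => G.Adj z v)) with hP
  have hf : ∀ p ∈ P, ∃ z', φ x z' = φ p.1 p.2 ∧ z' ∈ (T.erase y).erase zg := by
    rintro ⟨z, v⟩ hp
    simp only [hP, Finset.mem_sigma, Finset.mem_filter] at hp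
    obtain ⟨hz, hv, hadj⟩ := hp
    have h0 := hne0 z hz v hv hadj
    simp only [hT, Finset.mem_filter, Finset.mem_univ, true_and] at hz
    obtain ⟨l0, hl0⟩ := hz
    obtain ⟨l, hl, hfr⟩ := hl0.fresh' h hc hW hγ
    have hfr := hfr v hv h0
    have hcc := hl.cols_card h hc hγ
    obtain ⟨α, a1, a2, _, a3⟩ := hW.choose h hv hv (cols φ γ l).toFinset (by omega)
    have hE := (hl.claimE h hc hW hγ hv h0 hfr a1 a2 (by simpa using a3)).1
    have hle := h.le z v
    obtain ⟨z', hz'⟩ := h.ex_edge (by omega) hle hE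
    refine ⟨z', hz', ?_⟩
    simp only [Finset.mem_erase, hT, Finset.mem_filter, Finset.mem_univ, true_and]
    refine ⟨?_, ?_, _, Pth.step z v z' l hl hv h0 hz' hfr⟩
    · rintro rfl
      apply hfr
      rw [← hz', hzg]; simp [cols]
    · rintro rfl
      rw [h.xy0] at hz'; omega
  have : Nonempty V := ⟨x⟩
  choose! f hf1 hf2 using hf
  have hcard : P.card ≤ ((T.erase y).erase zg).card := by
    apply Finset.card_le_card_of_injOn f (fun p hp => hf2 p hp)
    rintro ⟨z, v⟩ hp ⟨z', v'⟩ hp' e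
    have e1 := hf1 _ hp
    have e2 := hf1 _ hp'
    rw [e, e2] at e1
    simp only [Finset.mem_coe, hP, Finset.mem_sigma, Finset.mem_filter] at hp hp'
    have h0 := hne0 z hp.1 v hp.2.1 hp.2.2
    have q1 := hp.1
    have q2 := hp'.1
    simp only [hT, Finset.mem_filter, Finset.mem_univ, true_and] at q1 q2
    obtain ⟨l, hl⟩ := q1
    obtain ⟨l', hl'⟩ := q2
    obtain ⟨r1, r2⟩ := hl.inj2 h hc hW hγ hl' hp.2.1 hp'.2.1 h0 e1.symm
    rw [r1, r2]
  rw [Finset.card_erase_of_mem (by simp [hzgT, hyzg.symm]), Finset.card_erase_of_mem hyT] at hcard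
  rw [hP, Finset.card_sigma, ← Finset.add_sum_erase _ _ hyT] at hcard
  have h2 : 2 ≤ T.card := by
    have : ({y, zg} : Finset V) ⊆ T := by
      intro a; simp; rintro (rfl | rfl) <;> assumption
    have := Finset.card_le_card this
    rwa [Finset.card_pair hyzg] at this
  have h3 : ((T.erase y).filter (fun z => ¬ ∀ v ∈ W, ¬ G.Adj z v)).card ≤
      ∑ z ∈ T.erase y, (W.filter (fun v => G.Adj z v)).card := by
    rw [Finset.card_filter]
    apply Finset.sum_le_sum
    intro z _
    by_cases hh : ∀ v ∈ W, ¬ G.Adj z v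
    · rw [if_neg (not_not.2 hh)]; exact Nat.zero_le _
    · rw [if_pos hh]
      push Not at hh
      obtain ⟨v, hv, hadj⟩ := hh
      exact Finset.card_pos.2 ⟨v, by simp [hv, hadj]⟩
  have h4 := Finset.card_filter_add_card_filter_not (s := T.erase y) (fun z => ∀ v ∈ W, ¬ G.Adj z v)
  rw [Finset.card_erase_of_mem hyT] at h4
  have h5 : (T.erase y).filter (fun z => ∀ v ∈ W, ¬ G.Adj z v) ⊆ (G.neighborFinset x).filter (fun z => z ≠ y ∧ ∀ v ∈ W, ¬ G.Adj z v) := by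
    intro z hz
    simp only [Finset.mem_filter, Finset.mem_erase] at hz
    simp only [Finset.mem_filter, SimpleGraph.mem_neighborFinset]
    exact ⟨hTN z hz.1.2, hz.1.1, hz.2⟩
  have h6 := Finset.card_le_card h5
  omega

end leaves

set_option linter.unusedSectionVars false

section top
variable {V : Type*} [Fintype V] {G : SimpleGraph V} [DecidableRel G.Adj] {D : ℕ} {x y : V}
  {φ : V → V → ℕ}

lemma PC.modx2 (h : PC G D x y φ) (hc : Cr G D) {α ε δ : ℕ} (hα : α ∈ ms D φ x) (hε : 1 ≤ ε)
    (hε' : ε ≤ D) (hδα : α ≠ δ) (hγ : ∃ γ ∈ ms D φ y, γ ≠ δ) :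
    ∃ φ' : V → V → ℕ, PC G D x y φ' ∧ (∀ c, c ≠ α → c ≠ ε →
      ∀ u v, φ' u v = c ↔ φ u v = c) ∧ ε ∈ ms D φ' x ∧ (∃ γ ∈ ms D φ' y, γ ≠ δ) ∧
      ∃ p : V, ∀ v, v ≠ x → v ≠ p → (ε ∈ ms D φ v → ε ∈ ms D φ' v) := by
  have ha := mem_ms.1 hα
  set C := comp φ α ε x with hCd
  have hC : KC φ α ε C := h.kc_comp ha.1 hε x
  have hxC : x ∈ C := SimpleGraph.Reachable.refl x
  refine ⟨swp φ α ε C, h.kswap ha.1 hε ha.2.1 hε' hC, fun c c1 c2 u v => swp_other c1 c2,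
    ms_swp_in_right hxC hε hε' hα, ?_, ?_⟩
  · obtain ⟨γ, h1, h2⟩ := hγ
    have f1 := h.F1 hc.no hα h1
    by_cases e : γ = ε
    · subst e
      exact ⟨α, ms_swp_in_left f1.2 ha.1 ha.2.1 h1, hδα⟩
    · exact ⟨γ, (ms_swp_other f1.1.symm e).2 h1, h2⟩
  by_cases hp : ∃ p ∈ C, p ≠ x ∧ (α ∈ ms D φ p ∨ ε ∈ ms D φ p)
  · obtain ⟨p, hpC, hpx, hp⟩ := hp
    refine ⟨p, fun v hvx hvp hv => ?_⟩
    have hvC : v ∉ C := fun hvC =>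
        h.three_ends ha.1 hε hpx.symm hvx.symm hvp.symm (Or.inl hα) hp (Or.inr hv) hpC hvC
    rw [ms_swp_out hvC]; exact hv
  · refine ⟨x, fun v hvx _ hv => ?_⟩
    have hvC : v ∉ C := fun hvC => hp ⟨v, hvC, hvx, Or.inr hv⟩
    rw [ms_swp_out hvC]; exact hv

/-- invariant for the pigeonhole argument -/
structure TI (G : SimpleGraph V) (D : ℕ) (x y : V) (z v : V → V) (δ e1 e2 e3 : ℕ)
    (φ : V → V → ℕ) (P : Finset V) : Prop where
  pc : PC G D x y φ
  inj : ∀ p ∈ P, ∀ q ∈ P, v p = v q → p = q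
  vx : ∀ p ∈ P, v p ≠ x
  c0 : ∀ p ∈ P, φ y p ≠ 0
  cz : ∀ p ∈ P, φ x (z p) = φ y p
  cv : ∀ p ∈ P, φ (z p) (v p) = δ
  m1 : ∀ p ∈ P, e1 ∈ ms D φ p
  m2 : ∀ p ∈ P, e2 ∈ ms D φ (v p)
  m3 : ∀ p ∈ P, e3 ∈ ms D φ (v p)
  g : ∃ γ ∈ ms D φ y, γ ≠ δ

variable {z v : V → V} {δ e1 e2 e3 : ℕ} {P : Finset V}

lemma TI.mod (h : TI G D x y z v δ e1 e2 e3 φ P) (hc : Cr G D) (hk : G.degree x + 10 ≤ D)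
    (hδ : 1 ≤ δ) {E : ℕ}
    (hE1 : 1 ≤ E) (hED : E ≤ D) (hEδ : E ≠ δ) :
    ∃ φ' P', TI G D x y z v δ e1 e2 e3 φ' P' ∧ P.card ≤ P'.card + 3 ∧ E ∈ ms D φ' x ∧
      ∀ c, (c = e1 ∨ c = e2 ∨ c = e3) → c ∈ ms D φ x → c ∈ ms D φ' x := by
  classical
  have hcx := h.pc.card_ms_x
  obtain ⟨α, ha, hb⟩ := Finset.exists_mem_notMem_of_card_lt_card
    (s := ({δ, e1, e2, e3} : Finset ℕ)) (t := ms D φ x)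
    (by have := Finset.card_le_four (a := δ) (b := e1) (c := e2) (d := e3); omega)
  simp only [Finset.mem_insert, Finset.mem_singleton, not_or] at hb
  obtain ⟨φ', p1, p2, p3, p4, p0, p5⟩ := h.pc.modx2 hc ha hE1 hED hb.1 h.g
  have keep : ∀ c, (c = e1 ∨ c = e2 ∨ c = e3) → ∀ u, u ≠ x → u ≠ p0 → c ∈ ms D φ u →
      c ∈ ms D φ' u := by
    intro c hc' u hux hup hcu
    by_cases e : c = E
    · subst e; exact p5 u hux hup hcu
    · exact (ms_congr (p2 c (by grind) e) u).2 hcu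
  have ha' := mem_ms.1 ha
  refine ⟨φ', P.filter (fun p => p ≠ p0 ∧ v p ≠ p0 ∧ φ y p ≠ E), ?_, ?_, p3, ?_⟩
  · have key : ∀ p ∈ P, φ y p ≠ E → φ' y p = φ y p ∧ φ' x (z p) = φ y p := by
      intro p hp hne
      have hz := h.cz p hp
      have hne2 : φ y p ≠ α := by
        intro e; exact ha'.2.2 (z p) (by rw [hz]; exact e)
      exact ⟨(p2 _ hne2 hne y p).2 rfl, (p2 _ hne2 hne x (z p)).2 hz⟩
    have hpx : ∀ p ∈ P, p ≠ x := by
      rintro p hp rfl; exact h.c0 p hp h.pc.yx0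
    constructor
    · exact p1
    · intro p hp q hq; exact h.inj p (Finset.mem_filter.1 hp).1 q (Finset.mem_filter.1 hq).1
    · intro p hp; exact h.vx p (Finset.mem_filter.1 hp).1
    · intro p hp
      obtain ⟨hp, q1, q2, q3⟩ := Finset.mem_filter.1 hp
      rw [(key p hp q3).1]; exact h.c0 p hp
    · intro p hp
      obtain ⟨hp, q1, q2, q3⟩ := Finset.mem_filter.1 hp
      rw [(key p hp q3).1, (key p hp q3).2]
    · intro p hp
      obtain ⟨hp, q1, q2, q3⟩ := Finset.mem_filter.1 hp
      exact (p2 δ (Ne.symm hb.1) hEδ.symm _ _).2 (h.cv p hp)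
    · intro p hp
      obtain ⟨hp, q1, q2, q3⟩ := Finset.mem_filter.1 hp
      exact keep e1 (by tauto) p (hpx p hp) q1 (h.m1 p hp)
    · intro p hp
      obtain ⟨hp, q1, q2, q3⟩ := Finset.mem_filter.1 hp
      exact keep e2 (by tauto) _ (h.vx p hp) q2 (h.m2 p hp)
    · intro p hp
      obtain ⟨hp, q1, q2, q3⟩ := Finset.mem_filter.1 hp
      exact keep e3 (by tauto) _ (h.vx p hp) q2 (h.m3 p hp)
    · exact p4
  · have hsub : P ⊆ (((P.filter (fun p => p ≠ p0 ∧ v p ≠ p0 ∧ φ y p ≠ E)) ∪ P.filter (fun p => p = p0))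
        ∪ P.filter (fun p => v p = p0)) ∪ P.filter (fun p => φ y p = E) := by
      intro p hp
      simp only [Finset.mem_union, Finset.mem_filter]
      tauto
    have c0 := Finset.card_le_card hsub
    have c1 : (P.filter (fun p => p = p0)).card ≤ 1 := by
      rw [Finset.card_le_one]; intro a ha b hb; simp at ha hb; rw [ha.2, hb.2]
    have c2 : (P.filter (fun p => v p = p0)).card ≤ 1 := by
      rw [Finset.card_le_one]; intro a ha b hb; simp only [Finset.mem_filter] at ha hb
      exact h.inj a ha.1 b hb.1 (ha.2.trans hb.2.symm)
    have c3 : (P.filter (fun p => φ y p = E)).card ≤ 1 := by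
      rw [Finset.card_le_one]; intro a ha b hb; simp only [Finset.mem_filter] at ha hb
      exact h.pc.inj y a b (ha.2.trans hb.2.symm) (by omega)
    have d1 := Finset.card_union_le (P.filter (fun p => p ≠ p0 ∧ v p ≠ p0 ∧ φ y p ≠ E)) (P.filter (fun p => p = p0))
    have d2 := Finset.card_union_le ((P.filter (fun p => p ≠ p0 ∧ v p ≠ p0 ∧ φ y p ≠ E)) ∪ (P.filter (fun p => p = p0))) (P.filter (fun p => v p = p0))
    have d3 := Finset.card_union_le (((P.filter (fun p => p ≠ p0 ∧ v p ≠ p0 ∧ φ y p ≠ E)) ∪ (P.filter (fun p => p = p0))) ∪ (P.filter (fun p => v p = p0))) (P.filter (fun p => φ y p = E))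
    omega
  · intro c hc' hcx
    by_cases e : c = E
    · subst e; exact p3
    · exact (ms_congr (p2 c (by grind) e) x).2 hcx

lemma TI.final (h : TI G D x y z v δ e1 e2 e3 φ P) (hc : Cr G D) (hδ : 1 ≤ δ)
    (n12 : e1 ≠ e2) (n13 : e1 ≠ e3) (n23 : e2 ≠ e3) (d1 : e1 ≠ δ)
    (x1 : e1 ∈ ms D φ x) (x2 : e2 ∈ ms D φ x) (x3 : e3 ∈ ms D φ x) : P.card ≤ 1 := by
  obtain ⟨γ, hγ, hγδ⟩ := h.g
  have key : ∀ p ∈ P, R φ e2 δ x (v p) := by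
    intro p hp
    obtain ⟨φ', p1, p2, p3, p4⟩ := h.pc.move hc hγ (h.c0 p hp) x1 (h.m1 p hp) (h.cz p hp)
    have nM : ∀ c ∈ ms D φ x, c ≠ γ ∧ c ≠ φ y p := by
      intro c hc'
      refine ⟨(h.pc.F1 hc.no hc' hγ).1, ?_⟩
      rintro rfl
      exact (mem_ms.1 hc').2.2 _ (h.cz p hp)
    have a2 := p4 e2 (by have := mem_ms.1 x2; omega) n12.symm (nM _ x2).1 (nM _ x2).2
    have a3 := p4 e3 (by have := mem_ms.1 x3; omega) n13.symm (nM _ x3).1 (nM _ x3).2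
    have hδβ : δ ≠ φ y p := by
      intro e
      have h1 := h.cv p hp
      have h2 := h.cz p hp
      exact h.vx p hp (h.pc.inj (z p) (v p) x (by rw [h1, h.pc.symm, h2, e]) (by omega))
    have aδ := p4 δ (by omega) d1.symm hγδ.symm hδβ
    have e := (aδ (z p) (v p)).2 (h.cv p hp)
    have f := p1.F3 hc (w := v p) (by rw [e]; omega) n23 ((p2 e2).2 x2)
      ((ms_congr a2 _).2 (h.m2 p hp)) ((p2 e3).2 x3) ((ms_congr a3 _).2 (h.m3 p hp))
    rw [e, R_congr a2 aδ] at f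
    exact f
  rw [Finset.card_le_one]
  intro a ha b hb
  apply h.inj a ha b hb
  by_contra hne
  exact h.pc.three_ends (mem_ms.1 x2).1 hδ (h.vx a ha).symm (h.vx b hb).symm hne (Or.inl x2)
    (Or.inl (h.m2 a ha)) (Or.inl (h.m2 b hb)) (key a ha) (key b hb)

lemma TI.bound (h : TI G D x y z v δ e1 e2 e3 φ P) (hc : Cr G D) (hk : G.degree x + 10 ≤ D)
    (hδ : 1 ≤ δ) (n12 : e1 ≠ e2) (n13 : e1 ≠ e3) (n23 : e2 ≠ e3) (d1 : e1 ≠ δ) (d2 : e2 ≠ δ)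
    (d3 : e3 ≠ δ) (r1 : 1 ≤ e1 ∧ e1 ≤ D) (r2 : 1 ≤ e2 ∧ e2 ≤ D) (r3 : 1 ≤ e3 ∧ e3 ≤ D) :
    P.card ≤ 10 := by
  obtain ⟨φ1, P1, t1, c1, m1, k1⟩ := h.mod hc hk hδ r1.1 r1.2 d1
  obtain ⟨φ2, P2, t2, c2, m2, k2⟩ := t1.mod hc hk hδ r2.1 r2.2 d2
  obtain ⟨φ3, P3, t3, c3, m3, k3⟩ := t2.mod hc hk hδ r3.1 r3.2 d3
  have := t3.final hc hδ n12 n13 n23 d1 (k3 _ (by tauto) (k2 _ (by tauto) m1)) (k3 _ (by tauto) m2) m3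
  omega

lemma pig {ι : Type*} (P : Finset ι) (F : ι → Finset ℕ) (m : ℕ) (hD : 1 ≤ D)
    (hF : ∀ p ∈ P, ∀ c ∈ F p, 1 ≤ c ∧ c ≤ D) (hm : ∀ p ∈ P, m ≤ (F p).card) :
    ∃ c, 1 ≤ c ∧ c ≤ D ∧ P.card * m ≤ (P.filter (fun p => c ∈ F p)).card * D := by
  by_contra hcon
  push Not at hcon
  have h1 : P.card * m ≤ ∑ p ∈ P, (F p).card := by
    rw [← smul_eq_mul]; exact Finset.card_nsmul_le_sum _ _ _ hm
  have h2 : ∑ p ∈ P, (F p).card = ∑ c ∈ Finset.Icc 1 D, (P.filter (fun p => c ∈ F p)).card := by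
    simp only [Finset.card_filter]
    rw [Finset.sum_comm]
    apply Finset.sum_congr rfl
    intro p hp
    rw [← Finset.card_filter]
    congr 1
    ext c
    simp only [Finset.mem_filter, Finset.mem_Icc]
    have := hF p hp c
    tauto
  have h3 : ∑ c ∈ Finset.Icc 1 D, (P.filter (fun p => c ∈ F p)).card * D <
      ∑ c ∈ Finset.Icc 1 D, P.card * m := by
    apply Finset.sum_lt_sum_of_nonempty
    · exact ⟨1, by simp; exact hD⟩
    · intro c hc
      simp at hc
      exact hcon c hc.1 hc.2
  rw [← Finset.sum_mul, ← h2] at h3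
  simp at h3
  nlinarith

lemma pig101 {ι : Type*} (P : Finset ι) (F : ι → Finset ℕ) (hD : 1 ≤ D)
    (hF : ∀ p ∈ P, ∀ c ∈ F p, 1 ≤ c ∧ c ≤ D) (hm : ∀ p ∈ P, D ≤ 101 * (F p).card) :
    ∃ c, 1 ≤ c ∧ c ≤ D ∧ P.card ≤ 101 * (P.filter (fun p => c ∈ F p)).card := by
  obtain ⟨c, h1, h2, h3⟩ := pig P F ((D + 100) / 101) hD hF (by
    intro p hp; have := hm p hp; omega)
  refine ⟨c, h1, h2, ?_⟩
  set m := (D + 100) / 101 with hmm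
  have h4 : D ≤ 101 * m := by omega
  have h5 : 0 < m := by omega
  have h6 : P.card * m ≤ (101 * (P.filter (fun p => c ∈ F p)).card) * m := by nlinarith
  exact Nat.le_of_mul_le_mul_right h6 h5

lemma PC.top_bad (h : PC G D x y φ) (hc : Cr G D) (hD : 10 ^ 6 ≤ D)
    (hk : 100 * G.degree x ≤ 99 * D) (t : ℕ) (Bd : Finset V) (S : V → Finset V)
    (hS : ∀ u w, w ∈ S u → G.Adj u w ∧ w ≠ x ∧ 100 * G.degree w ≤ 99 * D)
    (hB : ∀ w ∈ Bd, 100 * G.degree w ≤ 99 * D ∧ φ y w ≠ 0 ∧ φ x (z w) = φ y w ∧ t ≤ (S (z w)).card)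
    (hbig : 11 * 101 ^ 3 * D ≤ Bd.card * (t - 1)) : False := by
  classical
  obtain ⟨γ, hγ⟩ := h.ex_y hc
  have hzx : ∀ w ∈ Bd, z w ≠ x := by
    intro w hw e
    obtain ⟨_, h1, h2, _⟩ := hB w hw
    rw [e, h.self0] at h2; exact h1 h2.symm
  have hne0 : ∀ w ∈ Bd, ∀ u ∈ S (z w), φ (z w) u ≠ 0 := by
    intro w hw u hu
    have h1 := hzx w hw
    have h2 := hS _ _ hu
    rw [h.ne0]
    exact ⟨h2.1, by tauto, by tauto⟩
  obtain ⟨δ, d1, d2, d3⟩ := pig (D := D) Bd (fun w => ((S (z w)).image (φ (z w))).erase γ) (t - 1) (by omega)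
    (by
      intro w hw c hc'
      simp only [Finset.mem_erase, Finset.mem_image] at hc'
      obtain ⟨_, u, hu, rfl⟩ := hc'
      have := hne0 w hw u hu
      have := h.le (z w) u
      omega)
    (by
      intro w hw
      have h1 := Finset.pred_card_le_card_erase (s := (S (z w)).image (φ (z w))) (a := γ)
      rw [Finset.card_image_of_injOn] at h1
      · have := (hB w hw).2.2.2; omega
      · intro a ha b hb e
        exact h.inj (z w) a b e (hne0 w hw a ha))
  set P0 := Bd.filter (fun w => δ ∈ ((S (z w)).image (φ (z w))).erase γ) with hP0
  have hP0m : ∀ w ∈ P0, w ∈ Bd ∧ γ ≠ δ ∧ ∃ u, u ∈ S (z w) ∧ φ (z w) u = δ := by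
    intro w hw
    simp only [hP0, Finset.mem_filter, Finset.mem_erase, Finset.mem_image] at hw
    exact ⟨hw.1, hw.2.1.symm, hw.2.2⟩
  have c0 : 11 * 101 ^ 3 ≤ P0.card := by
    have : 11 * 101 ^ 3 * D ≤ P0.card * D := le_trans hbig d3
    exact Nat.le_of_mul_le_mul_right this (by omega)
  have : Nonempty V := ⟨x⟩
  have hex : ∀ w ∈ P0, ∃ u, u ∈ S (z w) ∧ φ (z w) u = δ := fun w hw => (hP0m w hw).2.2
  choose! v hv1 hv2 using hex
  have hms : ∀ u, 100 * G.degree u ≤ 99 * D → ∀ F : Finset ℕ, F.card ≤ 3 →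
      D ≤ 101 * (ms D φ u \ F).card := by
    intro u hu F hF
    have h1 := h.card_ms_ge u
    have h2 := Finset.le_card_sdiff F (ms D φ u)
    omega
  have hr : ∀ u (F : Finset ℕ), ∀ c ∈ ms D φ u \ F, 1 ≤ c ∧ c ≤ D := by
    intro u F c hc'
    have := mem_ms.1 (Finset.mem_sdiff.1 hc').1
    omega
  obtain ⟨e1, r1, r1', q1⟩ := pig101 (D := D) P0 (fun w => ms D φ w \ {δ}) (by omega)
    (fun p _ => hr p _) (fun p hp => hms p (hB p (hP0m p hp).1).1 _ (by simp))
  set P1 := P0.filter (fun w => e1 ∈ ms D φ w \ {δ}) with hP1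
  have s1 : P1 ⊆ P0 := Finset.filter_subset _ _
  obtain ⟨e2, r2, r2', q2⟩ := pig101 (D := D) P1 (fun w => ms D φ (v w) \ {δ, e1}) (by omega)
    (fun p _ => hr _ _) (fun p hp => hms _ (hS _ _ (hv1 p (s1 hp))).2.2 _
      (le_trans Finset.card_le_two (by norm_num)))
  set P2 := P1.filter (fun w => e2 ∈ ms D φ (v w) \ {δ, e1}) with hP2
  have s2 : P2 ⊆ P1 := Finset.filter_subset _ _
  obtain ⟨e3, r3, r3', q3⟩ := pig101 (D := D) P2 (fun w => ms D φ (v w) \ {δ, e1, e2}) (by omega)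
    (fun p _ => hr _ _) (fun p hp => hms _ (hS _ _ (hv1 p (s1 (s2 hp)))).2.2 _ Finset.card_le_three)
  set P3 := P2.filter (fun w => e3 ∈ ms D φ (v w) \ {δ, e1, e2}) with hP3
  have s3 : P3 ⊆ P2 := Finset.filter_subset _ _
  have c3 : 11 ≤ P3.card := by omega
  obtain ⟨p, hp⟩ := Finset.card_pos.1 (show 0 < P3.card by omega)
  have f3 : ∀ p ∈ P3, e3 ∈ ms D φ (v p) ∧ e3 ≠ δ ∧ e3 ≠ e1 ∧ e3 ≠ e2 := by
    intro p hp
    have := (Finset.mem_filter.1 hp).2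
    simpa using this
  have f2 : ∀ p ∈ P2, e2 ∈ ms D φ (v p) ∧ e2 ≠ δ ∧ e2 ≠ e1 := by
    intro p hp
    have := (Finset.mem_filter.1 hp).2
    simpa using this
  have f1 : ∀ p ∈ P1, e1 ∈ ms D φ p ∧ e1 ≠ δ := by
    intro p hp
    have := (Finset.mem_filter.1 hp).2
    simpa using this
  have g3 := (f3 p hp).2
  have g2 := (f2 p (s3 hp)).2
  have g1 := (f1 p (s2 (s3 hp))).2
  have hTI : TI G D x y z v δ e1 e2 e3 φ P3 := by
    have b0 : ∀ p ∈ P3, p ∈ P0 := fun p hp => s1 (s2 (s3 hp))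
    have bb : ∀ p ∈ P3, p ∈ Bd := fun p hp => (hP0m p (b0 p hp)).1
    refine ⟨h, ?_, ?_, ?_, ?_, ?_, ?_, ?_, ?_, ?_⟩
    · intro p hp q hq e
      have h1 := hv2 p (b0 p hp)
      have h2 := hv2 q (b0 q hq)
      rw [e, h.symm] at h1
      rw [h.symm] at h2
      have h3 : z p = z q := h.inj (v q) _ _ (by rw [h1, h2]) (by omega)
      have h4 := hB p (bb p hp)
      have h5 := hB q (bb q hq)
      exact h.inj y p q (by rw [← h4.2.2.1, ← h5.2.2.1, h3]) h4.2.1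
    · intro p hp; exact (hS _ _ (hv1 p (b0 p hp))).2.1
    · intro p hp; exact (hB p (bb p hp)).2.1
    · intro p hp; exact (hB p (bb p hp)).2.2.1
    · intro p hp; exact hv2 p (b0 p hp)
    · intro p hp; exact (f1 p (s2 (s3 hp))).1
    · intro p hp; exact (f2 p (s3 hp)).1
    · intro p hp; exact (f3 p hp).1
    · exact ⟨γ, hγ, (hP0m p (b0 p hp)).2.1⟩
  have := hTI.bound hc (by omega) d1 g2.2.symm g3.2.1.symm g3.2.2.symm g1 g2.1 g3.1 ⟨r1, r1'⟩ ⟨r2, r2'⟩ ⟨r3, r3'⟩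
  omega

lemma few_small [DecidableEq V] (s : Finset V) (k : ℕ) (hk : k ≤ D)
    (hsum : ∑ w ∈ s, (D - G.degree w) + 1 ≤ k)
    (hs : ∀ w ∈ s, 100 * G.degree w ≤ 99 * D) : s.card ≤ 99 := by
  by_contra hcon
  push Not at hcon
  have h1 : s.card * D ≤ ∑ w ∈ s, 100 * (D - G.degree w) := by
    rw [← smul_eq_mul]
    apply Finset.card_nsmul_le_sum
    intro w hw
    have := hs w hw
    omega
  rw [← Finset.mul_sum] at h1
  nlinarith

theorem top_lemma [DecidableEq V] (hc : Cr G D) (hD : 10 ^ 6 ≤ D)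
    (hk : 100 * G.degree x ≤ 99 * D) (t b : ℕ) (S : V → Finset V)
    (hS : ∀ u, S u = (G.neighborFinset u).filter (fun w => w ≠ x ∧ 100 * G.degree w ≤ 99 * D))
    (hbig : 11 * 101 ^ 3 * D ≤ b * (t - 1)) (hxy : G.Adj x y) :
    (S y).card ≤ 99 + b + ((G.neighborFinset x).filter (fun z => (S z).card < t)).card := by
  classical
  obtain ⟨φ, h⟩ := hc.ex x y hxy
  have hS' : ∀ u w, w ∈ S u → G.Adj u w ∧ w ≠ x ∧ 100 * G.degree w ≤ 99 * D := by
    intro u w hw; rw [hS] at hw; simpa using hw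
  have hval := (h.val hc (by omega)).2
  have hne0 : ∀ w ∈ S y, φ y w ≠ 0 := by
    intro w hw
    have h1 := hS' y w hw
    have h2 := hxy.ne
    rw [h.ne0]
    exact ⟨h1.1, by tauto, by tauto⟩
  have hA : ((S y).filter (fun w => φ y w ∈ ms D φ x)).card ≤ 99 := by
    apply few_small (G := G) (D := D) _ (G.degree x) (by omega) _ _
    · refine le_trans ?_ hval
      apply Nat.add_le_add_right
      apply Finset.sum_le_sum_of_subset
      intro w hw
      simp only [Finset.mem_filter, SimpleGraph.mem_neighborFinset] at hw ⊢
      exact ⟨(hS' y w hw.1).1, hw.2⟩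
    · intro w hw
      exact (hS' y w (Finset.mem_filter.1 hw).1).2.2
  have : Nonempty V := ⟨x⟩
  have hex : ∀ w, (w ∈ S y ∧ φ y w ∉ ms D φ x) → ∃ z, φ x z = φ y w := by
    rintro w ⟨hw, hw2⟩
    have := hne0 w hw
    exact h.ex_edge (by omega) (h.le y w) hw2
  choose! z hz using hex
  set Q := (S y).filter (fun w => φ y w ∉ ms D φ x) with hQ
  have hQm : ∀ w ∈ Q, w ∈ S y ∧ φ y w ∉ ms D φ x := fun w hw => Finset.mem_filter.1 hw
  have hsplit := Finset.card_filter_add_card_filter_not (s := S y) (fun w => φ y w ∈ ms D φ x)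
  rw [← hQ] at hsplit
  have hsplit2 := Finset.card_filter_add_card_filter_not (s := Q) (fun w => t ≤ (S (z w)).card)
  have hbad : (Q.filter (fun w => t ≤ (S (z w)).card)).card ≤ b := by
    by_contra hcon
    push Not at hcon
    apply h.top_bad hc hD hk t (Q.filter (fun w => t ≤ (S (z w)).card)) S hS' (z := z)
    · intro w hw
      obtain ⟨h1, h2⟩ := Finset.mem_filter.1 hw
      have h3 := hQm w h1
      exact ⟨(hS' y w h3.1).2.2, hne0 w h3.1, hz w h3, h2⟩
    · exact le_trans hbig (Nat.mul_le_mul_right _ hcon.le)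
  have hgood : (Q.filter (fun w => ¬ t ≤ (S (z w)).card)).card ≤
      ((G.neighborFinset x).filter (fun z => (S z).card < t)).card := by
    apply Finset.card_le_card_of_injOn z
    · intro w hw
      obtain ⟨h1, h2⟩ := Finset.mem_filter.1 hw
      have h3 := hQm w h1
      simp only [Finset.coe_filter, Set.mem_ofPred_eq, SimpleGraph.mem_neighborFinset]
      refine ⟨h.adj' ?_, by omega⟩
      rw [hz w h3]; exact hne0 w h3.1
    · intro a ha b hb e
      have h1 := hQm a (Finset.mem_filter.1 ha).1
      have h2 := hQm b (Finset.mem_filter.1 hb).1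
      exact h.inj y a b (by rw [← hz a h1, ← hz b h2, e]) (hne0 a h1.1)
  omega

end top

set_option linter.unusedSectionVars false

section weights
variable {V : Type*} [Fintype V] {G : SimpleGraph V} [DecidableRel G.Adj] {D : ℕ} {x y : V}

/-- weight factor -/
noncomputable def gg (D d : ℕ) : ℝ := if 100 * d ≤ 99 * D then 2 / √(d : ℝ) else 3 / √(d : ℝ)

/-- weight -/
noncomputable def om (D d : ℕ) : ℝ := (1 - (d : ℝ) / D) * gg D d

lemma gg_nonneg (D d : ℕ) : 0 ≤ gg D d := by
  unfold gg; split_ifs <;> positivity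

lemma gg_pos {D d : ℕ} (hd : 0 < d) : 0 < gg D d := by
  have : 0 < √(d : ℝ) := Real.sqrt_pos.2 (by exact_mod_cast hd)
  unfold gg; split_ifs <;> positivity

lemma gg_le (D d : ℕ) : gg D d ≤ 3 / √(d : ℝ) := by
  unfold gg; split_ifs
  · gcongr; norm_num
  · exact le_rfl

lemma one_sub_nonneg {D d : ℕ} (h : d ≤ D) : 0 ≤ 1 - (d : ℝ) / D := by
  have : (d : ℝ) / D ≤ 1 := div_le_one_of_le₀ (by exact_mod_cast h) (by positivity)
  linarith

lemma om_nonneg {D d : ℕ} (h : d ≤ D) : 0 ≤ om D d :=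
  mul_nonneg (one_sub_nonneg h) (gg_nonneg D d)

lemma om_small {D d : ℕ} (h2 : 100 * d ≤ 99 * D) :
    om D d = (1 - (d : ℝ) / D) * (2 / √(d : ℝ)) := by
  simp [om, gg, h2]

lemma om_le {D d m : ℕ} (h : d ≤ D) (h2 : 100 * d ≤ 99 * D) (hm : 0 < m) (hmd : m ≤ d) :
    om D d ≤ (1 - (m : ℝ) / D) * (2 / √(m : ℝ)) := by
  rw [om_small h2]
  have h0 : 0 < √(m : ℝ) := Real.sqrt_pos.2 (by exact_mod_cast hm)
  have h1 : (m : ℝ) ≤ d := by exact_mod_cast hmd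
  have h2 := one_sub_nonneg h
  gcongr
  exact one_sub_nonneg (hmd.trans h)

lemma om_le' {D d m : ℕ} (h : d ≤ D) (h2 : 100 * d ≤ 99 * D) (hm : 0 < m) (hmd : m ≤ d) :
    om D d ≤ 2 / √(m : ℝ) := by
  refine (om_le h h2 hm hmd).trans ?_
  have : 0 ≤ (m : ℝ) / D := by positivity
  have h0 : 0 < √(m : ℝ) := Real.sqrt_pos.2 (by exact_mod_cast hm)
  have h3 : 0 < 2 / √(m : ℝ) := by positivity
  nlinarith

lemma om_le_one {D d : ℕ} (h : d ≤ D) (h2 : 100 * d ≤ 99 * D) (h4 : 4 ≤ d) : om D d ≤ 1 := by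
  refine (om_le' h h2 (m := 4) (by norm_num) h4).trans ?_
  have : √((4 : ℕ) : ℝ) = 2 := by
    rw [show ((4 : ℕ) : ℝ) = 2 ^ 2 by norm_num]; exact Real.sqrt_sq (by norm_num)
  rw [this]; norm_num

lemma hi [DecidableEq V] (hc : Cr G D) (hxy : G.Adj x y) (hk : G.degree x + 2 ≤ D) (T : Finset V)
    (hT : T ⊆ G.neighborFinset y) (Q h : ℝ) (hQ : 0 < Q) (hh : 0 ≤ h)
    (hTd : ∀ w ∈ T, Q ≤ G.degree w ∧ (D : ℝ) - G.degree w ≤ h) :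
    ∑ w ∈ T, om D (G.degree w) ≤ 3 * G.degree x / √Q * ((h + 1) / D) := by
  obtain ⟨B, hBN, hxB, hBc, hsum⟩ := valw hc hxy hk
  have hD : (0 : ℝ) < D := by exact_mod_cast (by omega : 0 < D)
  have hsQ : 0 < √Q := Real.sqrt_pos.2 hQ
  have h1 : ∀ w ∈ T, om D (G.degree w) ≤ 3 / √Q * (((D : ℝ) - G.degree w) / D) := by
    intro w hw
    have h2 := (hTd w hw).1
    have h3 := one_sub_nonneg (hc.deg w)
    have h4 : gg D (G.degree w) ≤ 3 / √Q := by
      refine (gg_le _ _).trans ?_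
      gcongr
    unfold om
    have : ((D : ℝ) - G.degree w) / D = 1 - (G.degree w : ℝ) / D := by field_simp
    rw [this, mul_comm]
    gcongr
  have h2 : ∑ w ∈ T, ((D : ℝ) - G.degree w) ≤ G.degree x * (h + 1) := by
    rw [← Finset.sum_filter_add_sum_filter_not T (fun w => w ∈ B)]
    have a1 : ∑ w ∈ T.filter (fun w => w ∈ B), ((D : ℝ) - G.degree w) ≤ G.degree x * h := by
      have : ∑ w ∈ T.filter (fun w => w ∈ B), ((D : ℝ) - G.degree w) ≤
          (T.filter (fun w => w ∈ B)).card • h := by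
        apply Finset.sum_le_card_nsmul
        intro w hw
        exact (hTd w (Finset.mem_filter.1 hw).1).2
      refine this.trans ?_
      rw [nsmul_eq_mul]
      have h3 : (T.filter (fun w => w ∈ B)).card ≤ B.card :=
        Finset.card_le_card (fun w hw => (Finset.mem_filter.1 hw).2)
      have : ((T.filter (fun w => w ∈ B)).card : ℝ) ≤ G.degree x := by
        exact_mod_cast (by omega)
      gcongr
    have a2 : ∑ w ∈ T.filter (fun w => ¬ w ∈ B), ((D : ℝ) - G.degree w) ≤ G.degree x := by
      have e : ∀ w, (D : ℝ) - G.degree w = ((D - G.degree w : ℕ) : ℝ) := by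
        intro w; rw [Nat.cast_sub (hc.deg w)]
      simp only [e]
      rw [← Nat.cast_sum]
      have : ∑ w ∈ T.filter (fun w => ¬ w ∈ B), (D - G.degree w) ≤
          ∑ w ∈ G.neighborFinset y \ B, (D - G.degree w) := by
        apply Finset.sum_le_sum_of_subset
        intro w hw
        rw [Finset.mem_filter] at hw
        exact Finset.mem_sdiff.2 ⟨hT hw.1, hw.2⟩
      exact_mod_cast (by omega)
    linarith
  calc ∑ w ∈ T, om D (G.degree w) ≤ ∑ w ∈ T, 3 / √Q * (((D : ℝ) - G.degree w) / D) :=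
        Finset.sum_le_sum h1
    _ = 3 / √Q / D * ∑ w ∈ T, ((D : ℝ) - G.degree w) := by
        rw [Finset.mul_sum]; apply Finset.sum_congr rfl; intro w _; ring
    _ ≤ 3 / √Q / D * (G.degree x * (h + 1)) := by gcongr
    _ = _ := by ring

lemma lo0 [DecidableEq V] (hc : Cr G D) (h4 : ∀ v, 4 ≤ G.degree v) (hD : 1000 ≤ D) (T : Finset V)
    (hT : T ⊆ G.neighborFinset y) (hne : T.Nonempty) (hTd : ∀ w ∈ T, 100 * G.degree w ≤ 99 * D) :
    ∃ x' ∈ T, (∀ w ∈ T, G.degree x' ≤ G.degree w) ∧ ∃ s : ℕ, s ≤ G.degree x' ∧ s ≤ T.card ∧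
      ∑ w ∈ T, om D (G.degree w) ≤
        s * ((1 - (G.degree x' : ℝ) / D) * (2 / √(G.degree x' : ℝ))) + 99 := by
  obtain ⟨x', hx', hmin⟩ := Finset.exists_min_image T (fun w => G.degree w) hne
  refine ⟨x', hx', hmin, ?_⟩
  have hd := hTd x' hx'
  obtain ⟨B, hBN, hxB, hBc, hsum⟩ := valw hc (x := x') (y := y)
    (by have := hT hx'; rw [SimpleGraph.mem_neighborFinset] at this; exact this.symm) (by omega)
  have h3 : (T.filter (fun w => w ∈ B)).card ≤ B.card :=
        Finset.card_le_card (fun w hw => (Finset.mem_filter.1 hw).2)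
  refine ⟨(T.filter (fun w => w ∈ B)).card, by omega, Finset.card_filter_le _ _, ?_⟩
  rw [← Finset.sum_filter_add_sum_filter_not T (fun w => w ∈ B)]
  apply add_le_add
  · rw [← nsmul_eq_mul]
    apply Finset.sum_le_card_nsmul
    intro w hw
    have hw' := (Finset.mem_filter.1 hw).1
    have := h4 x'
    exact om_le (hc.deg w) (hTd w hw') (by omega) (hmin w hw')
  · have : ∑ w ∈ T.filter (fun w => ¬ w ∈ B), om D (G.degree w) ≤
      (T.filter (fun w => ¬ w ∈ B)).card • (1 : ℝ) := by
      apply Finset.sum_le_card_nsmul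
      intro w hw
      have hw' := (Finset.mem_filter.1 hw).1
      exact om_le_one (hc.deg w) (hTd w hw') (h4 w)
    refine this.trans ?_
    rw [nsmul_eq_mul, mul_one]
    have := few_small (G := G) (D := D) (T.filter (fun w => ¬ w ∈ B)) (G.degree x') (by omega)
      (by
        refine le_trans ?_ hsum
        apply Nat.add_le_add_right
        apply Finset.sum_le_sum_of_subset
        intro w hw
        rw [Finset.mem_filter] at hw
        exact Finset.mem_sdiff.2 ⟨hT hw.1, hw.2⟩)
      (fun w hw => hTd w (Finset.mem_filter.1 hw).1)
    exact_mod_cast this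

lemma lo1 [DecidableEq V] (hc : Cr G D) (h4 : ∀ v, 4 ≤ G.degree v) (hD : 1000 ≤ D) (T : Finset V)
    (hT : T ⊆ G.neighborFinset y) (hTd : ∀ w ∈ T, 100 * G.degree w ≤ 99 * D) :
    ∑ w ∈ T, om D (G.degree w) ≤ 2 * √(T.card : ℝ) + 99 := by
  rcases T.eq_empty_or_nonempty with rfl | hne
  · simp
  obtain ⟨x', hx', hmin, s, hs1, hs2, hs3⟩ := lo0 hc h4 hD T hT hne hTd
  refine hs3.trans (add_le_add ?_ le_rfl)
  have hm : 0 < G.degree x' := by have := h4 x'; omega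
  set m := G.degree x'
  have h0 : 0 < √(m : ℝ) := Real.sqrt_pos.2 (by exact_mod_cast hm)
  have h1 : (1 - (m : ℝ) / D) * (2 / √(m : ℝ)) ≤ 2 / √(m : ℝ) := by
    have : 0 ≤ (m : ℝ) / D := by positivity
    have h3 : 0 < 2 / √(m : ℝ) := by positivity
    nlinarith
  have h2 : √(s : ℝ) ≤ √(m : ℝ) := Real.sqrt_le_sqrt (by exact_mod_cast hs1)
  have h3 : √(s : ℝ) ≤ √(T.card : ℝ) := Real.sqrt_le_sqrt (by exact_mod_cast hs2)
  calc (s : ℝ) * ((1 - (m : ℝ) / D) * (2 / √(m : ℝ))) ≤ s * (2 / √(m : ℝ)) := by gcongr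
    _ = 2 * √(s : ℝ) * (√(s : ℝ) / √(m : ℝ)) := by
        nth_rewrite 1 [← Real.mul_self_sqrt (show (0 : ℝ) ≤ s by positivity)]; ring
    _ ≤ 2 * √(s : ℝ) * 1 := by
        gcongr; exact div_le_one_of_le₀ h2 h0.le
    _ ≤ 2 * √(T.card : ℝ) := by linarith

lemma lo2 [DecidableEq V] (hc : Cr G D) (h4 : ∀ v, 4 ≤ G.degree v) (T : Finset V)
    (hTd : ∀ w ∈ T, 100 * G.degree w ≤ 99 * D) :
    ∑ w ∈ T, om D (G.degree w) ≤ T.card := by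
  have : ∑ w ∈ T, om D (G.degree w) ≤ T.card • (1 : ℝ) := by
    apply Finset.sum_le_card_nsmul
    intro w hw
    exact om_le_one (hc.deg w) (hTd w hw) (h4 w)
  simpa using this

/-- total weight at `y` -/
noncomputable def Ds (G : SimpleGraph V) [DecidableRel G.Adj] (D : ℕ) (y : V) : ℝ :=
  ∑ w ∈ G.neighborFinset y, om D (G.degree w)

lemma Ds_pos (hc : Cr G D) (h4 : ∀ v, 4 ≤ G.degree v) (hxy : G.Adj x y) (hk : G.degree x < D) :
    0 < Ds G D y := by
  apply Finset.sum_pos'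
  · intro w _; exact om_nonneg (hc.deg w)
  · refine ⟨x, by simpa using hxy.symm, ?_⟩
    have := h4 x
    have hD : (0 : ℝ) < D := by exact_mod_cast (by omega : 0 < D)
    have h1 : (G.degree x : ℝ) < D := by exact_mod_cast hk
    have : (G.degree x : ℝ) / D < 1 := by rw [div_lt_one hD]; exact h1
    exact mul_pos (by linarith) (gg_pos (by omega))

open Classical in
/-- neighbors with degree at most `Q` -/
noncomputable def nb (G : SimpleGraph V) [DecidableRel G.Adj] (Q : ℝ) (y : V) : Finset V :=
  (G.neighborFinset y).filter (fun w => (G.degree w : ℝ) ≤ Q)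

lemma Ds_le [DecidableEq V] (hc : Cr G D) (h4 : ∀ v, 4 ≤ G.degree v) (hxy : G.Adj x y)
    (hk : G.degree x + 2 ≤ D) (Q : ℝ) (hQ : 0 < Q) (hQ2 : 100 * Q ≤ 99 * D) :
    Ds G D y ≤ ∑ w ∈ nb G Q y, om D (G.degree w) + 3 * G.degree x / √Q * ((D - Q + 1) / D) := by
  classical
  unfold Ds
  rw [← Finset.sum_filter_add_sum_filter_not (G.neighborFinset y) (fun w => (G.degree w : ℝ) ≤ Q)]
  apply add_le_add
  · apply le_of_eq; apply Finset.sum_congr _ (fun _ _ => rfl)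
    simp [nb]
  · apply hi hc hxy hk _ (Finset.filter_subset _ _) Q (D - Q) hQ
    · have : (0 : ℝ) ≤ D := by positivity
      linarith
    · intro w hw
      have := (Finset.mem_filter.1 hw).2
      push Not at this
      exact ⟨this.le, by linarith⟩

lemma nb_small {Q : ℝ} (hQ2 : 100 * Q ≤ 99 * D) : ∀ w ∈ nb G Q y, 100 * G.degree w ≤ 99 * D := by
  intro w hw
  have := (Finset.mem_filter.1 hw).2
  have h : (100 : ℝ) * G.degree w ≤ 99 * D := by linarith
  exact_mod_cast h

lemma nb_sub {Q : ℝ} : nb G Q y ⊆ G.neighborFinset y := Finset.filter_subset _ _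

lemma Ds_le1 [DecidableEq V] (hc : Cr G D) (h4 : ∀ v, 4 ≤ G.degree v) (hxy : G.Adj x y)
    (hk : G.degree x + 2 ≤ D) (hD : 1000 ≤ D) (Q : ℝ) (hQ : 0 < Q) (hQ2 : 100 * Q ≤ 99 * D) :
    Ds G D y ≤ 2 * √((nb G Q y).card : ℝ) + 99 + 3 * G.degree x / √Q * ((D - Q + 1) / D) := by
  refine (Ds_le hc h4 hxy hk Q hQ hQ2).trans ?_
  gcongr
  exact lo1 hc h4 hD _ nb_sub (nb_small hQ2)

lemma Ds_le2 [DecidableEq V] (hc : Cr G D) (h4 : ∀ v, 4 ≤ G.degree v) (hxy : G.Adj x y)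
    (hk : G.degree x + 2 ≤ D) (Q : ℝ) (hQ : 0 < Q) (hQ2 : 100 * Q ≤ 99 * D) :
    Ds G D y ≤ (nb G Q y).card + 3 * G.degree x / √Q * ((D - Q + 1) / D) := by
  refine (Ds_le hc h4 hxy hk Q hQ hQ2).trans ?_
  gcongr
  exact lo2 hc h4 _ (nb_small hQ2)

end weights

set_option linter.unusedSectionVars false

section ranges
variable {V : Type*} [Fintype V] {G : SimpleGraph V} [DecidableRel G.Adj] {D : ℕ} {x y : V}

lemma eps1 (k D : ℕ) (hD : 1000 ≤ D) :
    3 * (k : ℝ) / √((D : ℝ) / 4) * (((D : ℝ) - (D : ℝ) / 4 + 1) / D) ≤ 6 * k / √(D : ℝ) := by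
  have hD' : (1000 : ℝ) ≤ D := by exact_mod_cast hD
  have hR : 0 < √(D : ℝ) := Real.sqrt_pos.2 (by linarith)
  have h1 : √((D : ℝ) / 4) = √(D : ℝ) / 2 := by
    rw [Real.sqrt_div (by linarith), show (4 : ℝ) = 2 ^ 2 by norm_num, Real.sqrt_sq (by norm_num)]
  have h2 : ((D : ℝ) - (D : ℝ) / 4 + 1) / D ≤ 1 := by
    rw [div_le_one (by linarith)]; linarith
  have h3 : 0 ≤ 3 * (k : ℝ) / √((D : ℝ) / 4) := by positivity
  calc _ ≤ 3 * (k : ℝ) / √((D : ℝ) / 4) * 1 := by gcongr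
    _ = _ := by rw [h1]; field_simp; ring

lemma eps2 (k D : ℕ) (hD : 10 ^ 6 ≤ D) :
    3 * (k : ℝ) / √(99 / 100 * (D : ℝ)) * (((D : ℝ) - 99 / 100 * (D : ℝ) + 1) / D) ≤
      31 / 1000 * (k / √(D : ℝ)) := by
  have hD' : (10 ^ 6 : ℝ) ≤ D := by exact_mod_cast hD
  have hR : 0 < √(D : ℝ) := Real.sqrt_pos.2 (by linarith)
  have h1 : 99 / 100 * √(D : ℝ) ≤ √(99 / 100 * (D : ℝ)) := by
    apply Real.le_sqrt_of_sq_le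
    have := Real.sq_sqrt (show (0 : ℝ) ≤ D by linarith)
    rw [mul_pow, this]; nlinarith
  have h2 : ((D : ℝ) - 99 / 100 * (D : ℝ) + 1) / D ≤ 101 / 10000 := by
    rw [div_le_iff₀ (by linarith)]; linarith
  calc _ ≤ 3 * (k : ℝ) / (99 / 100 * √(D : ℝ)) * (101 / 10000) := by
        have : 0 ≤ ((D : ℝ) - 99 / 100 * (D : ℝ) + 1) / D := div_nonneg (by linarith) (by linarith)
        gcongr
    _ = (3 * 100 / 99 * 101 / 10000) * (k / √(D : ℝ)) := by field_simp
    _ ≤ _ := mul_le_mul_of_nonneg_right (by norm_num) (by positivity)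

lemma sum_lb (hc : Cr G D) (h4 : ∀ v, 4 ≤ G.degree v) (hk : G.degree x < D) (T : Finset V)
    (hT : T ⊆ G.neighborFinset x) (c : ℝ) (h : ∀ y ∈ T, Ds G D y ≤ c) :
    (T.card : ℝ) / c ≤ ∑ y ∈ G.neighborFinset x, 1 / Ds G D y := by
  have hp : ∀ y ∈ G.neighborFinset x, 0 < Ds G D y := fun y hy =>
    Ds_pos hc h4 ((SimpleGraph.mem_neighborFinset _ _ _).1 hy) hk
  calc (T.card : ℝ) / c = T.card • (1 / c) := by rw [nsmul_eq_mul]; ring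
    _ ≤ ∑ y ∈ T, 1 / Ds G D y := by
        apply Finset.card_nsmul_le_sum
        intro y hy
        exact one_div_le_one_div_of_le (hp y (hT hy)) (h y hy)
    _ ≤ _ := by
        apply Finset.sum_le_sum_of_subset_of_nonneg hT
        intro y hy _
        exact (one_div_pos.2 (hp y hy)).le

lemma target_small (hd : 100 * G.degree x ≤ 99 * D) :
    3 / gg D (G.degree x) = 3 / 2 * √(G.degree x : ℝ) := by
  simp only [gg, hd, if_true]
  rw [div_div_eq_mul_div]; ring

lemma nb_card (Q : ℝ) (hxy : G.Adj x y) (hx : (G.degree x : ℝ) ≤ Q) [DecidableEq V]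
    (S : Finset V) (hS : ∀ w, w ∈ S ↔ G.Adj y w ∧ w ≠ x ∧ (G.degree w : ℝ) ≤ Q) :
    (nb G Q y).card = S.card + 1 := by
  have : nb G Q y = insert x S := by
    ext w
    simp only [nb, Finset.mem_filter, SimpleGraph.mem_neighborFinset, Finset.mem_insert, hS]
    constructor
    · rintro ⟨h1, h2⟩
      by_cases h : w = x
      · exact Or.inl h
      · exact Or.inr ⟨h1, h, h2⟩
    · rintro (rfl | ⟨h1, h2, h3⟩)
      · exact ⟨hxy.symm, hx⟩
      · exact ⟨h1, h3⟩
  rw [this, Finset.card_insert_of_notMem]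
  simp [hS]

lemma leafs [DecidableEq V] (hc : Cr G D) (hD : 1000 ≤ D) (hk : 40000 * G.degree x ≤ D)
    (hxy : G.Adj x y) :
    1 ≤ (nb G ((D : ℝ) / 4) y).card ∧ (nb G ((D : ℝ) / 4) y).card ≤
      ((G.neighborFinset x).filter (fun z => (nb G ((D : ℝ) / 4) z).card = 1)).card := by
  classical
  set W : Finset V := Finset.univ.filter (fun v => v ≠ x ∧ 4 * G.degree v ≤ D) with hWdef
  have hq : ∀ v, (G.degree v : ℝ) ≤ (D : ℝ) / 4 ↔ 4 * G.degree v ≤ D := by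
    intro v
    rw [le_div_iff₀ (by norm_num), mul_comm]
    exact_mod_cast Iff.rfl
  have hW : WC G D x W := by
    refine ⟨by simp [W], ?_, ?_⟩
    · intro v hv
      simp only [W, Finset.mem_filter, Finset.mem_univ, true_and] at hv
      omega
    · intro v hv v' hv' _
      simp only [W, Finset.mem_filter, Finset.mem_univ, true_and] at hv hv'
      omega
  have hcard : ∀ z, G.Adj x z → (nb G ((D : ℝ) / 4) z).card =
      (W.filter (fun v => G.Adj z v)).card + 1 := by
    intro z hz
    apply nb_card _ hz ((hq x).2 (by omega))
    intro w
    simp only [W, Finset.mem_filter, Finset.mem_univ, true_and, hq]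
    tauto
  have hl := leaves hc hW hxy
  rw [hcard y hxy]
  refine ⟨by omega, hl.trans (Finset.card_le_card ?_)⟩
  intro z hz
  simp only [Finset.mem_filter, SimpleGraph.mem_neighborFinset] at hz ⊢
  refine ⟨hz.1, ?_⟩
  rw [hcard z hz.1]
  simp only [Nat.add_eq_right, Finset.card_eq_zero, Finset.filter_eq_empty_iff]
  exact fun v hv => hz.2.2 v hv

lemma sqrtD (hD : 6 ^ 30 ≤ D) : (470184984576 : ℝ) ≤ √(D : ℝ) := by
  apply Real.le_sqrt_of_sq_le
  have : ((6 ^ 30 : ℕ) : ℝ) ≤ D := by exact_mod_cast hD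
  refine le_trans ?_ this
  norm_num

/-- range 5 ≤ k ≤ 10^8 -/
lemma range2 (hc : Cr G D) (h4 : ∀ v, 4 ≤ G.degree v) (hD : 6 ^ 30 ≤ D)
    (h5 : 5 ≤ G.degree x) (h8 : G.degree x ≤ 10 ^ 8) :
    3 / gg D (G.degree x) < ∑ y ∈ G.neighborFinset x, 1 / Ds G D y := by
  classical
  have hR := sqrtD hD
  have hD3 : 6 ^ 30 = 221073919720733357899776 := by norm_num
  rw [hD3] at hD
  rw [target_small (by omega)]
  have hk5 : (5 : ℝ) ≤ G.degree x := by exact_mod_cast h5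
  have hk8 : (G.degree x : ℝ) ≤ 10 ^ 8 := by exact_mod_cast h8
  set s : V → ℕ := fun y => (nb G ((D : ℝ) / 4) y).card with hs
  have hne : (G.neighborFinset x).Nonempty := by
    rw [← Finset.card_pos, SimpleGraph.card_neighborFinset_eq_degree]; omega
  obtain ⟨ym, hym, hmax⟩ := Finset.exists_max_image _ s hne
  have hym' : G.Adj x ym := (SimpleGraph.mem_neighborFinset _ _ _).1 hym
  obtain ⟨hj1, hjL⟩ := leafs hc (by omega) (by omega) hym'
  set L := (G.neighborFinset x).filter (fun z => s z = 1) with hL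
  change s ym ≤ L.card at hjL
  change 1 ≤ s ym at hj1
  set j := s ym
  have hj : (1 : ℝ) ≤ j := by exact_mod_cast hj1
  have hDs : ∀ y ∈ G.neighborFinset x, Ds G D y ≤ s y * (1 + 13 / 10000) := by
    intro y hy
    have hy' : G.Adj x y := (SimpleGraph.mem_neighborFinset _ _ _).1 hy
    have hDp : (0 : ℝ) < D := by exact_mod_cast (by omega : 0 < D)
    have h1 := Ds_le2 hc h4 hy' (by omega) ((D : ℝ) / 4) (by linarith) (by linarith)
    have h2 := eps1 (G.degree x) D (by omega)
    have h3 : 6 * (G.degree x : ℝ) / √(D : ℝ) ≤ 13 / 10000 := by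
      rw [div_le_iff₀ (by linarith)]; linarith
    have h4 : (1 : ℝ) ≤ s y := by exact_mod_cast (leafs hc (by omega) (by omega) hy').1
    change Ds G D y ≤ s y + _ at h1
    linarith
  have hp : ∀ y ∈ G.neighborFinset x, 0 < Ds G D y := fun y hy =>
    Ds_pos hc h4 ((SimpleGraph.mem_neighborFinset _ _ _).1 hy) (by omega)
  have hLk : L.card ≤ G.degree x := by
    rw [← SimpleGraph.card_neighborFinset_eq_degree]; exact Finset.card_filter_le _ _
  have hsum : ((L.card : ℝ) + ((G.degree x : ℝ) - L.card) / j) / (1 + 13 / 10000) ≤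
      ∑ y ∈ G.neighborFinset x, 1 / Ds G D y := by
    rw [← Finset.sum_filter_add_sum_filter_not (G.neighborFinset x) (fun z => s z = 1), add_div]
    apply add_le_add
    · calc (L.card : ℝ) / (1 + 13 / 10000) = L.card • (1 / (1 + 13 / 10000) : ℝ) := by
            rw [nsmul_eq_mul]; ring
        _ ≤ _ := by
            apply Finset.card_nsmul_le_sum
            intro y hy
            rw [Finset.mem_filter] at hy
            apply one_div_le_one_div_of_le (hp y hy.1)
            have := hDs y hy.1
            rw [hy.2] at this; simpa using this
    · have hcc : ((G.degree x : ℝ) - L.card) =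
          (((G.neighborFinset x).filter (fun z => ¬ s z = 1)).card : ℝ) := by
        have := Finset.card_filter_add_card_filter_not (s := G.neighborFinset x) (fun z => s z = 1)
        rw [SimpleGraph.card_neighborFinset_eq_degree] at this
        rw [← this]; push_cast; ring
      rw [hcc]
      calc _ = ((G.neighborFinset x).filter (fun z => ¬ s z = 1)).card •
            (1 / (j * (1 + 13 / 10000)) : ℝ) := by
            rw [nsmul_eq_mul]; field_simp
        _ ≤ _ := by
            apply Finset.card_nsmul_le_sum
            intro y hy
            rw [Finset.mem_filter] at hy
            apply one_div_le_one_div_of_le (hp y hy.1)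
            refine (hDs y hy.1).trans ?_
            have : (s y : ℝ) ≤ j := by exact_mod_cast hmax y hy.1
            gcongr
  refine lt_of_lt_of_le ?_ hsum
  rw [lt_div_iff₀ (by norm_num)]
  have hjL' : (j : ℝ) ≤ L.card := by exact_mod_cast hjL
  have hq := Real.sq_sqrt (show (0 : ℝ) ≤ G.degree x by positivity)
  set q := √(G.degree x : ℝ)
  have hq0 : 0 ≤ q := Real.sqrt_nonneg _
  have hq2 : 22 / 10 ≤ q := by nlinarith
  have a1 : (j : ℝ) + ((G.degree x : ℝ) - j) / j ≤
      (L.card : ℝ) + ((G.degree x : ℝ) - L.card) / j := by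
    have : ((L.card : ℝ) - j) / j ≤ (L.card : ℝ) - j :=
      div_le_self (by linarith) hj
    have e : ((G.degree x : ℝ) - j) / j = ((G.degree x : ℝ) - L.card) / j + ((L.card : ℝ) - j) / j := by
      rw [← add_div]; ring
    rw [e]; linarith
  have a2 : 2 * q - 1 ≤ (j : ℝ) + ((G.degree x : ℝ) - j) / j := by
    have hj0 : (0 : ℝ) < j := by linarith
    rw [← sub_nonneg]
    have : (j : ℝ) + ((G.degree x : ℝ) - j) / j - (2 * q - 1) = (j - q) ^ 2 / j := by
      rw [← hq]; field_simp; ring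
    rw [this]; positivity
  nlinarith

/-- range 10^8 ≤ k ≤ D/40000 -/
lemma range3 (hc : Cr G D) (h4 : ∀ v, 4 ≤ G.degree v) (hD : 6 ^ 30 ≤ D)
    (h8 : 10 ^ 8 ≤ G.degree x) (hk : 40000 * G.degree x ≤ D) :
    3 / gg D (G.degree x) < ∑ y ∈ G.neighborFinset x, 1 / Ds G D y := by
  classical
  have hR := sqrtD hD
  have hD3 : 6 ^ 30 = 221073919720733357899776 := by norm_num
  rw [hD3] at hD
  rw [target_small (by omega)]
  have hDp : (0 : ℝ) < D := by exact_mod_cast (by omega : 0 < D)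
  have hk8 : (10 ^ 8 : ℝ) ≤ G.degree x := by exact_mod_cast h8
  have hkD : 40000 * (G.degree x : ℝ) ≤ D := by exact_mod_cast hk
  have hq := Real.sq_sqrt (show (0 : ℝ) ≤ G.degree x by positivity)
  have hRq := Real.sq_sqrt (show (0 : ℝ) ≤ D by positivity)
  have heps := eps1 (G.degree x) D (by omega)
  set q := √(G.degree x : ℝ)
  have hq0 : 0 ≤ q := Real.sqrt_nonneg _
  have hq2 : 10 ^ 4 ≤ q := by nlinarith
  have hqR : 200 * q ≤ √(D : ℝ) := by nlinarith
  have he : 6 * (G.degree x : ℝ) / √(D : ℝ) ≤ 3 / 100 * q := by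
    rw [div_le_iff₀ (by linarith), ← hq]; nlinarith
  by_cases hall : ∀ y ∈ G.neighborFinset x, 16 * (nb G ((D : ℝ) / 4) y).card ≤ G.degree x
  · refine lt_of_lt_of_le ?_ (sum_lb hc h4 (by omega) _ (Finset.Subset.refl _) (54 / 100 * q) ?_)
    · rw [SimpleGraph.card_neighborFinset_eq_degree, ← hq, lt_div_iff₀ (by linarith)]
      nlinarith
    · intro y hy
      have hy' : G.Adj x y := (SimpleGraph.mem_neighborFinset _ _ _).1 hy
      have h1 := Ds_le1 hc h4 hy' (by omega) (by omega) ((D : ℝ) / 4) (by linarith) (by linarith)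
      have h2 : √((nb G ((D : ℝ) / 4) y).card : ℝ) ≤ q / 4 := by
        apply Real.sqrt_le_iff.2 ⟨by linarith, ?_⟩
        have : 16 * ((nb G ((D : ℝ) / 4) y).card : ℝ) ≤ G.degree x := by exact_mod_cast hall y hy
        rw [div_pow, hq]; linarith
      linarith
  · push Not at hall
    obtain ⟨y, hy, hlt⟩ := hall
    have hy' : G.Adj x y := (SimpleGraph.mem_neighborFinset _ _ _).1 hy
    have hl := (leafs hc (by omega) (by omega) hy').2
    refine lt_of_lt_of_le ?_ (sum_lb hc h4 (by omega) _ (Finset.filter_subset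
      (fun z => (nb G ((D : ℝ) / 4) z).card = 1) _) (301 / 10000 * q) ?_)
    · rw [lt_div_iff₀ (by linarith)]
      have : (G.degree x : ℝ) ≤ 16 * ((G.neighborFinset x).filter
        (fun z => (nb G ((D : ℝ) / 4) z).card = 1)).card := by exact_mod_cast (by omega)
      rw [← hq] at this
      nlinarith
    · intro z hz
      rw [Finset.mem_filter] at hz
      have hz' : G.Adj x z := (SimpleGraph.mem_neighborFinset _ _ _).1 hz.1
      have h1 := Ds_le2 hc h4 hz' (by omega) ((D : ℝ) / 4) (by linarith) (by linarith)
      rw [hz.2] at h1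
      push_cast at h1
      linarith

/-- range D/40000 ≤ k ≤ 99D/100 -/
lemma range4 (hc : Cr G D) (h4 : ∀ v, 4 ≤ G.degree v) (hD : 6 ^ 30 ≤ D)
    (hk : D ≤ 40000 * G.degree x) (hk2 : 100 * G.degree x ≤ 99 * D) :
    3 / gg D (G.degree x) < ∑ y ∈ G.neighborFinset x, 1 / Ds G D y := by
  classical
  have hR := sqrtD hD
  have hD3 : 6 ^ 30 = 221073919720733357899776 := by norm_num
  rw [hD3] at hD
  rw [target_small (by omega)]
  have hDp : (0 : ℝ) < D := by exact_mod_cast (by omega : 0 < D)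
  have hk8 : (10 ^ 18 : ℝ) ≤ G.degree x := by exact_mod_cast (by omega)
  have hkD : (G.degree x : ℝ) ≤ D := by exact_mod_cast (by omega)
  have hk99 : (G.degree x : ℝ) ≤ 99 / 100 * D := by
    have : 100 * (G.degree x : ℝ) ≤ 99 * D := by exact_mod_cast hk2
    linarith
  have hq := Real.sq_sqrt (show (0 : ℝ) ≤ G.degree x by positivity)
  have heps := eps2 (G.degree x) D (by omega)
  have hqR : √(G.degree x : ℝ) ≤ √(D : ℝ) := Real.sqrt_le_sqrt hkD
  set q := √(G.degree x : ℝ)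
  have hq0 : 0 ≤ q := Real.sqrt_nonneg _
  have hq2 : 10 ^ 9 ≤ q := by nlinarith
  have he : (G.degree x : ℝ) / √(D : ℝ) ≤ q := by
    rw [div_le_iff₀ (by linarith), ← hq]; nlinarith
  set S : V → Finset V := fun u => (G.neighborFinset u).filter
    (fun w => w ≠ x ∧ 100 * G.degree w ≤ 99 * D) with hS
  have hnb : ∀ y, G.Adj x y → ((nb G (99 / 100 * (D : ℝ)) y).card : ℝ) = (S y).card + 1 := by
    intro y hy
    have := nb_card (99 / 100 * (D : ℝ)) hy hk99 (S y) (by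
      intro w
      have : (G.degree w : ℝ) ≤ 99 / 100 * D ↔ 100 * G.degree w ≤ 99 * D := by
        have h : 100 * G.degree w ≤ 99 * D ↔ (100 * G.degree w : ℝ) ≤ 99 * D := by
          exact_mod_cast Iff.rfl
        rw [h]; constructor <;> intro h <;> linarith
      simp only [S, Finset.mem_filter, SimpleGraph.mem_neighborFinset, this])
    rw [this]; push_cast; ring
  have hDs : ∀ y, G.Adj x y → ∀ r : ℝ, 0 ≤ r → ((S y).card : ℝ) + 1 ≤ r ^ 2 * q ^ 2 →
      Ds G D y ≤ 2 * (r * q) + 99 + 31 / 1000 * q := by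
    intro y hy r hr hle
    have h1 := Ds_le1 hc h4 hy (by omega) (by omega) (99 / 100 * (D : ℝ)) (by linarith) (by linarith)
    rw [hnb y hy] at h1
    have h2 : √(((S y).card : ℝ) + 1) ≤ r * q := by
      apply Real.sqrt_le_iff.2 ⟨by positivity, ?_⟩
      rw [mul_pow]; exact hle
    linarith
  by_cases hall : ∀ y ∈ G.neighborFinset x, 11 * (S y).card ≤ G.degree x
  · refine lt_of_lt_of_le ?_ (sum_lb hc h4 (by omega) _ (Finset.Subset.refl _) (65 / 100 * q) ?_)
    · rw [SimpleGraph.card_neighborFinset_eq_degree, ← hq, lt_div_iff₀ (by linarith)]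
      nlinarith
    · intro y hy
      have hy' : G.Adj x y := (SimpleGraph.mem_neighborFinset _ _ _).1 hy
      have h1 := hDs y hy' (302 / 1000) (by norm_num) (by
        have : 11 * ((S y).card : ℝ) ≤ G.degree x := by exact_mod_cast hall y hy
        rw [hq]; linarith)
      linarith
  · push Not at hall
    obtain ⟨y, hy, hlt⟩ := hall
    have hy' : G.Adj x y := (SimpleGraph.mem_neighborFinset _ _ _).1 hy
    have hl := top_lemma hc (by omega) hk2 (G.degree x / 10 ^ 4 + 2) (G.degree x / 200 + 1) S
      (fun u => rfl) (by
        have e1 : G.degree x ≤ 200 * (G.degree x / 200 + 1) := by omega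
        have e2 : G.degree x ≤ 10 ^ 4 * (G.degree x / 10 ^ 4 + 2 - 1) := by omega
        have e3 := Nat.mul_le_mul e1 e2
        have e4 : 10 ^ 18 ≤ G.degree x := by omega
        have e5 : 10 ^ 18 * G.degree x ≤ G.degree x * G.degree x := Nat.mul_le_mul_right _ e4
        have e6 : 200 * (G.degree x / 200 + 1) * (10 ^ 4 * (G.degree x / 10 ^ 4 + 2 - 1)) =
          2000000 * ((G.degree x / 200 + 1) * (G.degree x / 10 ^ 4 + 2 - 1)) := by ring
        rw [e6] at e3
        omega) hy'
    set T := (G.neighborFinset x).filter (fun z => (S z).card < G.degree x / 10 ^ 4 + 2) with hT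
    refine lt_of_lt_of_le ?_ (sum_lb hc h4 (by omega) T (Finset.filter_subset _ _)
      (515 / 10000 * q) ?_)
    · rw [lt_div_iff₀ (by linarith)]
      have : 858 * (G.degree x) ≤ 10000 * T.card := by
        have : 10 ^ 18 ≤ G.degree x := by omega
        omega
      have : 858 * (G.degree x : ℝ) ≤ 10000 * T.card := by exact_mod_cast this
      rw [← hq] at this
      nlinarith
    · intro z hz
      rw [Finset.mem_filter] at hz
      have hz' : G.Adj x z := (SimpleGraph.mem_neighborFinset _ _ _).1 hz.1
      have h1 := hDs z hz' (101 / 10000) (by norm_num) (by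
        have : 10 ^ 4 * (S z).card ≤ G.degree x + 10 ^ 4 := by omega
        have : 10 ^ 4 * ((S z).card : ℝ) ≤ G.degree x + 10 ^ 4 := by exact_mod_cast this
        rw [hq]; linarith)
      linarith

/-- range 99D/100 < k < D -/
lemma range5 (hc : Cr G D) (h4 : ∀ v, 4 ≤ G.degree v) (hD : 6 ^ 30 ≤ D)
    (hk : 99 * D < 100 * G.degree x) (hk2 : G.degree x < D) :
    3 / gg D (G.degree x) < ∑ y ∈ G.neighborFinset x, 1 / Ds G D y := by
  classical
  have hR := sqrtD hD
  have hD3 : 6 ^ 30 = 221073919720733357899776 := by norm_num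
  rw [hD3] at hD
  have ht : 3 / gg D (G.degree x) = √(G.degree x : ℝ) := by
    simp only [gg, not_le.2 hk, if_false]
    rw [div_div_eq_mul_div]; ring
  rw [ht]
  have hDp : (0 : ℝ) < D := by exact_mod_cast (by omega : 0 < D)
  have hRq := Real.sq_sqrt (show (0 : ℝ) ≤ D by positivity)
  have hq := Real.sq_sqrt (show (0 : ℝ) ≤ G.degree x by positivity)
  have hkk : 99 * (D : ℝ) < 100 * (G.degree x : ℝ) := by exact_mod_cast hk
  set R := √(D : ℝ) with hRdef
  set q := √(G.degree x : ℝ)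
  have hq0 : 0 ≤ q := Real.sqrt_nonneg _
  refine lt_of_lt_of_le ?_ (sum_lb hc h4 (by omega) _ (Finset.Subset.refl _) (81 / 100 * R) ?_)
  · rw [SimpleGraph.card_neighborFinset_eq_degree, ← hq, lt_div_iff₀ (by linarith)]
    have : 81 / 100 * R < q := by nlinarith
    have : 0 < q := by linarith
    nlinarith
  intro y hy
  have hy' : G.Adj x y := (SimpleGraph.mem_neighborFinset _ _ _).1 hy
  have hxN : x ∈ G.neighborFinset y := by simpa using hy'.symm
  obtain ⟨x', hx', hmin⟩ := Finset.exists_min_image (G.neighborFinset y) (fun w => G.degree w) ⟨x, hxN⟩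
  have hx'a : G.Adj x' y := by
    rw [SimpleGraph.mem_neighborFinset] at hx'; exact hx'.symm
  by_cases hm : G.degree x' + 2 ≤ D
  · have h1 := Ds_le hc h4 hx'a hm (99 / 100 * (D : ℝ)) (by linarith) (by linarith)
    have h2 := eps2 (G.degree x') D (by omega)
    have h3 : (G.degree x' : ℝ) / √(D : ℝ) ≤ R := by
      rw [div_le_iff₀ (by linarith), ← hRdef]
      have : (G.degree x' : ℝ) ≤ D := by exact_mod_cast hc.deg x'
      nlinarith
    have h4' : ∑ w ∈ nb G (99 / 100 * (D : ℝ)) y, om D (G.degree w) ≤ 77 / 100 * R + 99 + 1 / 1000 * R := by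
      rcases (nb G (99 / 100 * (D : ℝ)) y).eq_empty_or_nonempty with he | hne
      · rw [he, Finset.sum_empty]; linarith
      obtain ⟨u, hu, humin, s, hs1, hs2, hs3⟩ := lo0 hc h4 (by omega) _ nb_sub hne
        (nb_small (by linarith))
      have hsu : (s : ℝ) ≤ G.degree u := by exact_mod_cast hs1
      have h5 := one_sub_nonneg (hc.deg u)
      have hu4 := h4 u
      have hup : (0 : ℝ) < G.degree u := by exact_mod_cast (by omega)
      have hsq := Real.sq_sqrt hup.le
      have hsp := Real.sqrt_pos.2 hup
      set m := √(G.degree u : ℝ)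
      have h6 : (s : ℝ) * ((1 - (G.degree u : ℝ) / D) * (2 / m)) ≤ 2 * m * (1 - m ^ 2 / R ^ 2) := by
        calc _ ≤ (G.degree u : ℝ) * ((1 - (G.degree u : ℝ) / D) * (2 / m)) := by gcongr
          _ = _ := by rw [hRq, ← hsq]; field_simp
      have h7 : 2 * m * (1 - m ^ 2 / R ^ 2) ≤ 771 / 1000 * R := by
        have hRp : 0 < R := by linarith
        set r := m / R with hr
        have hr0 : 0 ≤ r := by positivity
        have e : 2 * m * (1 - m ^ 2 / R ^ 2) = 2 * r * (1 - r ^ 2) * R := by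
          rw [hr]; field_simp
        rw [e]
        have : 2 * r * (1 - r ^ 2) ≤ 771 / 1000 := by
          nlinarith [mul_nonneg hr0 (sq_nonneg (r - 577 / 1000)), sq_nonneg (r - 577 / 1000)]
        gcongr
      linarith
    linarith
  · have h1 : ∀ w ∈ G.neighborFinset y, om D (G.degree w) ≤ 3 / D := by
      intro w hw
      have hw1 := hmin w hw
      have a1 : (D : ℝ) ≤ G.degree w + 1 := by exact_mod_cast (by omega)
      have a2 : 1 - (G.degree w : ℝ) / D ≤ 1 / D := by
        rw [le_div_iff₀ hDp, sub_mul, div_mul_cancel₀ _ hDp.ne']; linarith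
      have a3 : gg D (G.degree w) ≤ 3 := by
        refine (gg_le _ _).trans ?_
        apply div_le_self (by norm_num)
        rw [Real.one_le_sqrt]
        have := h4 w
        exact_mod_cast (by omega)
      have a4 := gg_nonneg D (G.degree w)
      calc om D (G.degree w) ≤ 1 / D * 3 := by unfold om; gcongr
        _ = _ := by ring
    have h2 : Ds G D y ≤ (G.neighborFinset y).card • (3 / (D : ℝ)) :=
      Finset.sum_le_card_nsmul _ _ _ h1
    rw [nsmul_eq_mul, SimpleGraph.card_neighborFinset_eq_degree] at h2
    have h3 : (G.degree y : ℝ) * (3 / (D : ℝ)) ≤ D * (3 / (D : ℝ)) := by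
      have : (G.degree y : ℝ) ≤ D := by exact_mod_cast hc.deg y
      gcongr
    rw [mul_div_cancel₀ _ hDp.ne'] at h3
    linarith
end ranges

set_option linter.unusedSectionVars false

section rangefour
variable {V : Type*} [Fintype V] {G : SimpleGraph V} [DecidableRel G.Adj] {D : ℕ} {x y : V}

lemma range1_aux [DecidableEq V] (hc : Cr G D) (hD : 1000 ≤ D) (hx4 : G.degree x = 4)
    (L : Finset V) (hL2 : L.card ≤ 2) (a b va vb : V)
    (hN : ∀ z, G.Adj x z → z ∈ L ∨ z = a ∨ z = b) (ha : G.Adj x a) (hb : G.Adj x b)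
    (hva : G.Adj a va) (hvb : G.Adj b vb) (hvax : va ≠ x) (hvbx : vb ≠ x)
    (hda : G.degree va = 4) (hdb : G.degree vb = 4)
    (w : V) (hwx : w ≠ x) (hwa : w ≠ va) (hwb : w ≠ vb) (hxy : G.Adj x y) (hyw : G.Adj y w) :
    D ≤ G.degree w + 25 := by
  by_contra hlt
  push Not at hlt
  set W : Finset V := {va, vb, w} with hW
  have hWC : WC G D x W := by
    refine ⟨?_, ?_, ?_⟩
    · simp only [W, Finset.mem_insert, Finset.mem_singleton]
      rintro (h | h | h)
      · exact hvax h.symm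
      · exact hvbx h.symm
      · exact hwx h.symm
    · intro v hv
      simp only [W, Finset.mem_insert, Finset.mem_singleton] at hv
      rcases hv with rfl | rfl | rfl <;> omega
    · intro v hv v' hv' hne
      simp only [W, Finset.mem_insert, Finset.mem_singleton] at hv hv'
      rcases hv with rfl | rfl | rfl <;> rcases hv' with rfl | rfl | rfl <;>
        first | omega | exact absurd rfl hne
  set Z := (G.neighborFinset x).filter (fun z => ∀ v ∈ W, ¬ G.Adj z v) with hZ
  have hvaW : va ∈ W := by simp [W]
  have hvbW : vb ∈ W := by simp [W]
  have hwW : w ∈ W := by simp [W]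
  have hle : ∀ u, G.Adj x u → (W.filter (fun v => G.Adj u v)).card + 1 ≤ Z.card := by
    intro u hu
    refine (leaves hc hWC hu).trans (Finset.card_le_card ?_)
    intro z hz
    simp only [Finset.mem_filter, Z] at hz ⊢
    exact ⟨hz.1, hz.2.2⟩
  have hZL : Z ⊆ L := by
    intro z hz
    simp only [Finset.mem_filter, Z, SimpleGraph.mem_neighborFinset] at hz
    rcases hN z hz.1 with h | rfl | rfl
    · exact h
    · exact absurd hva (hz.2 va hvaW)
    · exact absurd hvb (hz.2 vb hvbW)
  have hZc := Finset.card_le_card hZL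
  have two : ∀ u v, G.Adj x u → G.Adj u v → G.Adj u w → v ∈ W → v ≠ w → False := by
    intro u v hu huv huw hv hvw
    have h1 := hle u hu
    have h2 : ({v, w} : Finset V).card ≤ (W.filter (fun v => G.Adj u v)).card := by
      apply Finset.card_le_card
      intro t ht
      simp only [Finset.mem_insert, Finset.mem_singleton] at ht
      rw [Finset.mem_filter]
      rcases ht with rfl | rfl
      · exact ⟨hv, huv⟩
      · exact ⟨hwW, huw⟩
    rw [Finset.card_pair hvw] at h2
    omega
  rcases hN y hxy with h | rfl | rfl
  · have hyZ : y ∉ Z := by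
      intro hz
      simp only [Finset.mem_filter, Z] at hz
      exact hz.2 w hwW hyw
    have h3 : Z ⊂ L := Finset.ssubset_iff_subset_ne.2 ⟨hZL, fun he => hyZ (he ▸ h)⟩
    have h4 := Finset.card_lt_card h3
    have h5 := hle a ha
    have h6 : 0 < (W.filter (fun v => G.Adj a v)).card :=
      Finset.card_pos.2 ⟨va, Finset.mem_filter.2 ⟨hvaW, hva⟩⟩
    omega
  · exact two _ va hxy hva hyw hvaW (Ne.symm hwa)
  · exact two _ vb hxy hvb hyw hvbW (Ne.symm hwb)

lemma range1 (hc : Cr G D) (h4 : ∀ v, 4 ≤ G.degree v) (hD : 6 ^ 30 ≤ D)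
    (hx4 : G.degree x = 4) :
    3 / gg D (G.degree x) < ∑ y ∈ G.neighborFinset x, 1 / Ds G D y := by
  classical
  have hR := sqrtD hD
  have hD3 : 6 ^ 30 = 221073919720733357899776 := by norm_num
  rw [hD3] at hD
  rw [target_small (by omega), hx4]
  have h2 : √((4 : ℕ) : ℝ) = 2 := by
    rw [show ((4 : ℕ) : ℝ) = 2 ^ 2 by norm_num]; exact Real.sqrt_sq (by norm_num)
  rw [h2]
  have hDp : (0 : ℝ) < D := by exact_mod_cast (by omega : 0 < D)
  have hDb : (1000 : ℝ) ≤ D := by exact_mod_cast (by omega : 1000 ≤ D)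
  set s : V → ℕ := fun y => (nb G ((D : ℝ) / 4) y).card with hs
  set L := (G.neighborFinset x).filter (fun z => s z = 1) with hL
  set P := (G.neighborFinset x).filter (fun z => ¬ s z = 1) with hP
  have hLP : L.card + P.card = 4 := by
    rw [← hx4, ← SimpleGraph.card_neighborFinset_eq_degree]
    exact Finset.card_filter_add_card_filter_not _
  have hadj : ∀ y ∈ G.neighborFinset x, G.Adj x y := fun y hy =>
    (SimpleGraph.mem_neighborFinset _ _ _).1 hy
  have hlf : ∀ y ∈ G.neighborFinset x, 1 ≤ s y ∧ s y ≤ L.card := fun y hy =>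
    leafs hc (by omega) (by omega) (hadj y hy)
  have hp : ∀ y ∈ G.neighborFinset x, 0 < Ds G D y := fun y hy =>
    Ds_pos hc h4 (hadj y hy) (by omega)
  have heps := eps1 (G.degree x) D (by omega)
  rw [hx4] at heps
  have he : 6 * ((4 : ℕ) : ℝ) / √(D : ℝ) ≤ 1 / 10 ^ 6 := by
    rw [div_le_iff₀ (by linarith)]; push_cast; linarith
  have hDs0 : ∀ y ∈ G.neighborFinset x, Ds G D y ≤
      ∑ w ∈ nb G ((D : ℝ) / 4) y, om D (G.degree w) + 1 / 10 ^ 6 := by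
    intro y hy
    have h1 := Ds_le hc h4 (hadj y hy) (by omega) ((D : ℝ) / 4) (by linarith) (by linarith)
    rw [hx4] at h1
    linarith
  have hDs : ∀ y ∈ G.neighborFinset x, Ds G D y ≤ s y + 1 / 10 ^ 6 := by
    intro y hy
    have h1 := hDs0 y hy
    have h2 := lo2 hc h4 (nb G ((D : ℝ) / 4) y) (nb_small (by linarith))
    change _ ≤ (s y : ℝ) at h2
    linarith
  rw [← Finset.sum_filter_add_sum_filter_not (G.neighborFinset x) (fun z => s z = 1)]
  change _ < ∑ y ∈ L, 1 / Ds G D y + ∑ y ∈ P, 1 / Ds G D y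
  have hLN : ∀ y ∈ L, y ∈ G.neighborFinset x ∧ s y = 1 := fun y hy => Finset.mem_filter.1 hy
  have hPN : ∀ y ∈ P, y ∈ G.neighborFinset x ∧ ¬ s y = 1 := fun y hy => Finset.mem_filter.1 hy
  have hsumL : (L.card : ℝ) * (1 / (1 + 1 / 10 ^ 6)) ≤ ∑ y ∈ L, 1 / Ds G D y := by
    rw [← nsmul_eq_mul]
    apply Finset.card_nsmul_le_sum
    intro y hy
    apply one_div_le_one_div_of_le (hp y (hLN y hy).1)
    have := hDs y (hLN y hy).1
    rw [(hLN y hy).2] at this; simpa using this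
  have hPnn : 0 ≤ ∑ y ∈ P, 1 / Ds G D y :=
    Finset.sum_nonneg (fun y hy => (one_div_pos.2 (hp y (hPN y hy).1)).le)
  have hsmall : ∀ y ∈ P, ∀ c : ℝ, Ds G D y ≤ c → 1 / c ≤ ∑ y ∈ P, 1 / Ds G D y := by
    intro y hy c hcc
    refine (one_div_le_one_div_of_le (hp y (hPN y hy).1) hcc).trans ?_
    exact Finset.single_le_sum (f := fun y => 1 / Ds G D y)
      (fun y hy => (one_div_pos.2 (hp y (hPN y hy).1)).le) hy
  rcases Nat.eq_zero_or_pos P.card with hP0 | hPpos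
  · have : L.card = 4 := by omega
    rw [this] at hsumL
    norm_num at hsumL hPnn ⊢
    linarith
  obtain ⟨a, haP⟩ := Finset.card_pos.1 hPpos
  have ha := hPN a haP
  have ha1 := hlf a ha.1
  by_cases hL3 : L.card = 3
  · rw [hL3] at hsumL ha1
    have h5 : Ds G D a ≤ 3 + 1 / 10 ^ 6 := by
      have := hDs a ha.1
      have h6 : (s a : ℝ) ≤ 3 := by exact_mod_cast ha1.2
      linarith
    have := hsmall a haP _ h5
    norm_num at hsumL this ⊢
    linarith
  have hL2 : L.card = 2 := by have := ha.2; omega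
  obtain ⟨a, b, hab, hPab⟩ := Finset.card_eq_two.1 (show P.card = 2 by omega)
  have haP : a ∈ P := by rw [hPab]; simp
  have hbP : b ∈ P := by rw [hPab]; simp
  have hsP : ∀ y ∈ P, s y = 2 := by
    intro y hy
    have h1 := hPN y hy
    have h2 := hlf y h1.1
    have := h1.2
    omega
  have hxle : (G.degree x : ℝ) ≤ (D : ℝ) / 4 := by rw [hx4]; push_cast; linarith
  have hv : ∀ y ∈ P, ∃ v, v ≠ x ∧ nb G ((D : ℝ) / 4) y = {x, v} := by
    intro y hy
    have h1 : x ∈ nb G ((D : ℝ) / 4) y := by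
      simp only [nb, Finset.mem_filter, SimpleGraph.mem_neighborFinset]
      exact ⟨(hadj y (hPN y hy).1).symm, hxle⟩
    obtain ⟨u, v, huv, he⟩ := Finset.card_eq_two.1 (hsP y hy)
    rw [he] at h1
    simp only [Finset.mem_insert, Finset.mem_singleton] at h1
    rcases h1 with rfl | rfl
    · exact ⟨v, huv.symm, he⟩
    · exact ⟨u, huv, by rw [he, Finset.pair_comm]⟩
  have hxo : om D (G.degree x) ≤ 1 := om_le_one (hc.deg x) (by omega) (h4 x)
  have hfive : ∀ y ∈ P, ∀ v, v ≠ x → nb G ((D : ℝ) / 4) y = {x, v} → G.degree v ≠ 4 →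
      Ds G D y ≤ 1895 / 1000 := by
    intro y hy v hvx hnb hd
    have h1 := hDs0 y (hPN y hy).1
    rw [hnb, Finset.sum_pair hvx.symm] at h1
    have hvm : v ∈ nb G ((D : ℝ) / 4) y := by rw [hnb]; simp
    have h6 : om D (G.degree v) ≤ 2 / √((5 : ℕ) : ℝ) := by
      have := h4 v
      exact om_le' (hc.deg v) (nb_small (by linarith) v hvm) (by norm_num) (by omega)
    have h7 : 2 / √((5 : ℕ) : ℝ) ≤ 8945 / 10000 := by
      have : (22360 / 10000 : ℝ) ≤ √((5 : ℕ) : ℝ) := by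
        apply Real.le_sqrt_of_sq_le; norm_num
      generalize √((5 : ℕ) : ℝ) = f at this
      rw [div_le_iff₀ (by linarith)]; linarith
    linarith
  have htwo : ∀ y ∈ P, Ds G D y ≤ 2 + 1 / 10 ^ 6 := by
    intro y hy
    have := hDs y (hPN y hy).1
    rw [hsP y hy] at this; simpa using this
  have hpair : ∑ y ∈ P, 1 / Ds G D y = 1 / Ds G D a + 1 / Ds G D b := by
    rw [hPab, Finset.sum_pair hab]
  obtain ⟨va, hvax, hnba⟩ := hv a haP
  obtain ⟨vb, hvbx, hnbb⟩ := hv b hbP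
  have hpa := hp a (hPN a haP).1
  have hpb := hp b (hPN b hbP).1
  rw [hpair]
  rw [hL2] at hsumL
  by_cases hda : G.degree va = 4
  swap
  · have h1 := one_div_le_one_div_of_le hpa (hfive a haP va hvax hnba hda)
    have h2 := one_div_le_one_div_of_le hpb (htwo b hbP)
    norm_num at hsumL h1 h2 ⊢
    linarith
  by_cases hdb : G.degree vb = 4
  swap
  · have h1 := one_div_le_one_div_of_le hpb (hfive b hbP vb hvbx hnbb hdb)
    have h2 := one_div_le_one_div_of_le hpa (htwo a haP)
    norm_num at hsumL h1 h2 ⊢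
    linarith
  have hmem : ∀ y w, w ∈ nb G ((D : ℝ) / 4) y ↔ G.Adj y w ∧ (G.degree w : ℝ) ≤ (D : ℝ) / 4 := by
    intro y w
    simp [nb, Finset.mem_filter, SimpleGraph.mem_neighborFinset]
  have hava : G.Adj a va := ((hmem a va).1 (by rw [hnba]; simp)).1
  have hbvb : G.Adj b vb := ((hmem b vb).1 (by rw [hnbb]; simp)).1
  have hbig : ∀ y ∈ G.neighborFinset x, ∀ w, G.Adj y w → w ∉ nb G ((D : ℝ) / 4) y →
      D ≤ G.degree w + 25 := by
    intro y hy w hyw hw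
    have hw' : ∀ u, G.degree u = 4 → w ≠ u := by
      rintro u hu rfl
      apply hw
      rw [hmem]
      refine ⟨hyw, ?_⟩
      rw [hu]; push_cast; linarith
    refine range1_aux hc (by omega) hx4 L hL2.le a b va vb ?_ (hadj a (hPN a haP).1)
      (hadj b (hPN b hbP).1) hava hbvb hvax hvbx hda hdb w (hw' x hx4) (hw' va hda) (hw' vb hdb)
      (hadj y hy) hyw
    intro z hz
    have hzN : z ∈ G.neighborFinset x := by simpa using hz
    by_cases h : s z = 1
    · exact Or.inl (Finset.mem_filter.2 ⟨hzN, h⟩)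
    · right
      have : z ∈ P := Finset.mem_filter.2 ⟨hzN, h⟩
      rw [hPab] at this
      simpa using this
  have hlt : ∀ y ∈ G.neighborFinset x, Ds G D y < s y := by
    intro y hy
    have h1 : Ds G D y = ∑ w ∈ nb G ((D : ℝ) / 4) y, om D (G.degree w) +
        ∑ w ∈ G.neighborFinset y \ nb G ((D : ℝ) / 4) y, om D (G.degree w) := by
      unfold Ds
      rw [add_comm, Finset.sum_sdiff nb_sub]
    have h2' : ∑ w ∈ nb G ((D : ℝ) / 4) y, om D (G.degree w) ≤ s y * (1 - 4 / D) := by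
      rw [← nsmul_eq_mul]
      apply Finset.sum_le_card_nsmul
      intro w hw
      have := om_le (hc.deg w) (nb_small (by linarith) w hw) (m := 4) (by norm_num) (h4 w)
      rw [h2] at this
      push_cast at this
      linarith
    have h3 := hi hc (hadj y hy) (by omega) (G.neighborFinset y \ nb G ((D : ℝ) / 4) y)
      Finset.sdiff_subset ((D : ℝ) / 4) 25 (by linarith) (by norm_num) (by
        intro w hw
        rw [Finset.mem_sdiff, SimpleGraph.mem_neighborFinset] at hw
        have h5 := hbig y hy w hw.1 hw.2
        have h6 : (D : ℝ) ≤ G.degree w + 25 := by exact_mod_cast h5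
        constructor <;> linarith)
    rw [hx4] at h3
    have h6 : √((D : ℝ) / 4) = √(D : ℝ) / 2 := by
      rw [Real.sqrt_div (by linarith), show (4 : ℝ) = 2 ^ 2 by norm_num, Real.sqrt_sq (by norm_num)]
    have h7 : 3 * ((4 : ℕ) : ℝ) / √((D : ℝ) / 4) ≤ 1 / 10 := by
      rw [h6, div_le_iff₀ (by linarith)]; push_cast; linarith
    have h8 : 3 * ((4 : ℕ) : ℝ) / √((D : ℝ) / 4) * ((25 + 1) / D) < 4 / D := by
      have : (0 : ℝ) < 1 / D := by positivity
      calc _ ≤ 1 / 10 * ((25 + 1) / (D : ℝ)) := by gcongr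
        _ = 26 / 10 * (1 / D) := by ring
        _ < 4 * (1 / D) := by nlinarith
        _ = _ := by ring
    have h9 : (1 : ℝ) ≤ s y := by exact_mod_cast (hlf y hy).1
    have h10 : (0 : ℝ) < 4 / D := by positivity
    nlinarith
  have hA : 1 / (2 : ℝ) < 1 / Ds G D a := by
    apply one_div_lt_one_div_of_lt hpa
    have := hlt a (hPN a haP).1
    rw [hsP a haP] at this; simpa using this
  have hB : 1 / (2 : ℝ) < 1 / Ds G D b := by
    apply one_div_lt_one_div_of_lt hpb
    have := hlt b (hPN b hbP).1
    rw [hsP b hbP] at this; simpa using this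
  have hLL : (2 : ℝ) ≤ ∑ y ∈ L, 1 / Ds G D y := by
    have : L.card • (1 : ℝ) ≤ ∑ y ∈ L, 1 / Ds G D y := by
      apply Finset.card_nsmul_le_sum
      intro y hy
      have h1 := hlt y (hLN y hy).1
      rw [(hLN y hy).2] at h1
      rw [one_le_div (hp y (hLN y hy).1)]
      push_cast at h1
      exact h1.le
    rw [hL2] at this
    simpa using this
  linarith

lemma key (hc : Cr G D) (h4 : ∀ v, 4 ≤ G.degree v) (hD : 6 ^ 30 ≤ D) (hk : G.degree x < D) :
    3 / gg D (G.degree x) < ∑ y ∈ G.neighborFinset x, 1 / Ds G D y := by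
  have h := h4 x
  have hD3 : 6 ^ 30 = 221073919720733357899776 := by norm_num
  have hD' := hD
  rw [hD3] at hD'
  by_cases h1 : G.degree x = 4
  · exact range1 hc h4 hD h1
  by_cases h2 : G.degree x ≤ 10 ^ 8
  · exact range2 hc h4 hD (by omega) h2
  by_cases h3 : 40000 * G.degree x ≤ D
  · exact range3 hc h4 hD (by omega) h3
  by_cases h5 : 100 * G.degree x ≤ 99 * D
  · exact range4 hc h4 hD (by omega) h5
  · exact range5 hc h4 hD (by omega) hk

lemma discharge (hc : Cr G D) (h4 : ∀ v, 4 ≤ G.degree v) (hD : 6 ^ 30 ≤ D) [Nonempty V]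
    (I : Finset V) (hI : ∀ u ∈ I, ∀ v ∈ I, u ≠ v → ¬ G.Adj u v) :
    (I.card : ℝ) < 4 * (Fintype.card V : ℝ) / 7 := by
  classical
  have hD3 : 6 ^ 30 = 221073919720733357899776 := by norm_num
  have hD' := hD
  rw [hD3] at hD'
  have hDp : (0 : ℝ) < D := by exact_mod_cast (by omega : 0 < D)
  set Y := Iᶜ with hY
  have hcard : (I.card : ℝ) + Y.card = Fintype.card V := by
    exact_mod_cast Finset.card_add_card_compl I
  have hnY : ∀ x ∈ I, G.neighborFinset x ⊆ Y := by
    intro x hx y hy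
    rw [SimpleGraph.mem_neighborFinset] at hy
    rw [hY, Finset.mem_compl]
    exact fun hyI => hI x hx y hyI hy.ne hy
  rcases I.eq_empty_or_nonempty with rfl | ⟨x0, hx0⟩
  · have : (0 : ℝ) < Fintype.card V := by exact_mod_cast Fintype.card_pos
    simp only [Finset.card_empty, Nat.cast_zero]
    positivity
  have hYpos : (0 : ℝ) < Y.card := by
    have h1 := Finset.card_le_card (hnY x0 hx0)
    rw [SimpleGraph.card_neighborFinset_eq_degree] at h1
    have := h4 x0
    exact_mod_cast (by omega)
  -- charge of x
  set ch : V → ℝ := fun x => ∑ y ∈ G.neighborFinset x,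
    (1 / (D : ℝ) + 1 / 3 * (om D (G.degree x) / Ds G D y)) with hch
  have hDs0 : ∀ y, 0 ≤ Ds G D y := fun y =>
    Finset.sum_nonneg (fun w _ => om_nonneg (hc.deg w))
  have hchlow : ∀ x, G.degree x < D → 1 < ch x := by
    intro x hx
    have hk := key hc h4 hD hx
    have hg : 0 < gg D (G.degree x) := gg_pos (by have := h4 x; omega)
    have e : ch x = (G.degree x : ℝ) / D + 1 / 3 * om D (G.degree x) *
        ∑ y ∈ G.neighborFinset x, 1 / Ds G D y := by
      rw [hch]
      simp only [Finset.sum_add_distrib, Finset.sum_const,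
        SimpleGraph.card_neighborFinset_eq_degree, nsmul_eq_mul, Finset.mul_sum]
      congr 1
      · ring
      · apply Finset.sum_congr rfl; intro y _; ring
    have hpos : 0 < 1 - (G.degree x : ℝ) / D := by
      rw [sub_pos, div_lt_one hDp]; exact_mod_cast hx
    rw [e]
    have : 1 / 3 * om D (G.degree x) * (3 / gg D (G.degree x)) = 1 - (G.degree x : ℝ) / D := by
      unfold om; field_simp
    have h2 : 1 / 3 * om D (G.degree x) * (3 / gg D (G.degree x)) <
        1 / 3 * om D (G.degree x) * ∑ y ∈ G.neighborFinset x, 1 / Ds G D y := by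
      apply mul_lt_mul_of_pos_left hk
      unfold om; positivity
    linarith
  have hchD : ∀ x, G.degree x = D → ch x = 1 := by
    intro x hx
    have : om D D = 0 := by unfold om; rw [div_self hDp.ne']; simp
    simp only [hch, hx, this, zero_div, mul_zero, add_zero, Finset.sum_const,
      SimpleGraph.card_neighborFinset_eq_degree, nsmul_eq_mul]
    field_simp
  have hch1 : ∀ x, 1 ≤ ch x := by
    intro x
    rcases (hc.deg x).lt_or_eq with h | h
    · exact (hchlow x h).le
    · exact (hchD x h).ge
  have hswap : ∑ x ∈ I, ch x = ∑ y ∈ Y, ∑ x ∈ I.filter (fun x => G.Adj x y),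
      (1 / (D : ℝ) + 1 / 3 * (om D (G.degree x) / Ds G D y)) := by
    rw [hch]
    apply Finset.sum_comm'
    intro x y
    simp only [Finset.mem_filter, SimpleGraph.mem_neighborFinset]
    constructor
    · rintro ⟨h1, h2⟩
      exact ⟨⟨h1, h2⟩, hnY x h1 (by simpa using h2)⟩
    · rintro ⟨⟨h1, h2⟩, _⟩
      exact ⟨h1, h2⟩
  have hsub : ∀ y, I.filter (fun x => G.Adj x y) ⊆ G.neighborFinset y := by
    intro y x hx
    rw [Finset.mem_filter] at hx
    simpa using hx.2.symm
  have hup : ∀ y ∈ Y, ∑ x ∈ I.filter (fun x => G.Adj x y),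
      (1 / (D : ℝ) + 1 / 3 * (om D (G.degree x) / Ds G D y)) ≤ 4 / 3 := by
    intro y _
    rw [Finset.sum_add_distrib, Finset.sum_const, nsmul_eq_mul, ← Finset.mul_sum, ← Finset.sum_div]
    have a1 : ((I.filter (fun x => G.Adj x y)).card : ℝ) * (1 / (D : ℝ)) ≤ 1 := by
      rw [mul_one_div, div_le_one hDp]
      have h1 := Finset.card_le_card (hsub y)
      rw [SimpleGraph.card_neighborFinset_eq_degree] at h1
      exact_mod_cast h1.trans (hc.deg y)
    have a2 : (∑ x ∈ I.filter (fun x => G.Adj x y), om D (G.degree x)) / Ds G D y ≤ 1 := by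
      apply div_le_one_of_le₀ _ (hDs0 y)
      apply Finset.sum_le_sum_of_subset_of_nonneg (hsub y)
      intro w _ _
      exact om_nonneg (hc.deg w)
    linarith
  have htot : ∑ x ∈ I, ch x ≤ 4 / 3 * Y.card := by
    rw [hswap]
    have := Finset.sum_le_card_nsmul Y _ (4 / 3 : ℝ) hup
    rw [nsmul_eq_mul] at this
    linarith
  have hfin : (I.card : ℝ) < 4 / 3 * Y.card := by
    by_cases hall : ∀ x ∈ I, G.degree x = D
    · have hsum : ∑ x ∈ I, ch x ≤ Y.card := by
        rw [hswap]
        have := Finset.sum_le_card_nsmul Y (fun y => ∑ x ∈ I.filter (fun x => G.Adj x y),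
          (1 / (D : ℝ) + 1 / 3 * (om D (G.degree x) / Ds G D y))) (1 : ℝ) (by
            intro y _
            have hz : om D D = 0 := by unfold om; rw [div_self hDp.ne']; simp
            have : ∑ x ∈ I.filter (fun x => G.Adj x y),
                (1 / (D : ℝ) + 1 / 3 * (om D (G.degree x) / Ds G D y)) =
                ∑ x ∈ I.filter (fun x => G.Adj x y), 1 / (D : ℝ) := by
              apply Finset.sum_congr rfl
              intro x hx
              rw [hall x (Finset.mem_filter.1 hx).1, hz]; simp
            rw [this, Finset.sum_const, nsmul_eq_mul, mul_one_div, div_le_one hDp]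
            have h1 := Finset.card_le_card (hsub y)
            rw [SimpleGraph.card_neighborFinset_eq_degree] at h1
            exact_mod_cast h1.trans (hc.deg y))
        simpa using this
      have h1 : ∑ x ∈ I, ch x = I.card := by
        rw [Finset.sum_congr rfl (fun x hx => hchD x (hall x hx))]; simp
      linarith
    · push Not at hall
      obtain ⟨x1, hx1, hne⟩ := hall
      have h1 : ∑ x ∈ I, (1 : ℝ) < ∑ x ∈ I, ch x :=
        Finset.sum_lt_sum (fun x _ => hch1 x) ⟨x1, hx1, hchlow x1 (lt_of_le_of_ne (hc.deg x1) hne)⟩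
      simp only [Finset.sum_const, nsmul_eq_mul, mul_one] at h1
      linarith
  linarith

end rangefour

theorem statement2 {V : Type*} [Fintype V] (G : SimpleGraph V) [DecidableRel G.Adj]
    (hG : IsDeltaCritical G) (hmin : ∀ v : V, 4 ≤ G.degree v) (hmax : 6 ^ 30 ≤ G.maxDegree) :
    (indepNum G : ℝ) < 4 * (Fintype.card V : ℝ) / 7 := by
  classical
  have hpos : 0 < G.maxDegree := lt_of_lt_of_le (by positivity) hmax
  have hc := cr_of_critical hG hpos
  have hV : Nonempty V := by
    by_contra h
    rw [not_nonempty_iff] at h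
    have : G.maxDegree ≤ 0 := G.maxDegree_le_of_forall_degree_le 0 (fun v => (h.false v).elim)
    omega
  have hmem : indepNum G ∈ {n | ∃ s : Finset V, (∀ u ∈ s, ∀ v ∈ s, u ≠ v → ¬ G.Adj u v) ∧ s.card = n} := by
    apply Nat.sSup_mem
    · exact ⟨0, ∅, by simp, by simp⟩
    · refine ⟨Fintype.card V, ?_⟩
      rintro n ⟨s, _, rfl⟩
      exact Finset.card_le_univ s
  obtain ⟨I, hI, hcard⟩ := hmem
  rw [← hcard]
  exact discharge hc hmin hmax I hI
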